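/- For any integer m ≥ 1 there exists a constant R(m) > 0 with the following property. Suppose (X,d) is a 1-hyperbolic strongly geodesic G-space, V ≤ G is a nontrivial subgroup, and H = (h₁,…,h_m) ∈ G^m is such that the G-pair M = (V;H) is minimal. Let U = ⟨V ∪ {h₁,…,h_m}⟩ ≤ G. Then either U = V ∗ F(H), or after replacing M by an equivalent G-pair M' = (V'; H' = (h'₁,…,h'_m)) one of the following holds: (1) l_{V'}(h'_i) ≤ R(m) for some i ∈ {1,…,m}; (2) there exists x ∈ X such that d(x, h'_i x) ≤ R(m) for some i ∈ {1,…,m}. -/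

import Mathlib

noncomputable section

namespace KW

open Metric Set Pointwise

variable {X : Type*} [MetricSpace X]

/-- `s` is (the image of) a unit-speed geodesic segment joining `x` to `y`. -/
def IsGeodesicSegment (s : Set X) (x y : X) : Prop :=
  ∃ (b : ℝ) (f : ℝ → X), 0 ≤ b ∧ f 0 = x ∧ f b = y ∧
    (∀ u ∈ Set.Icc (0 : ℝ) b, ∀ v ∈ Set.Icc (0 : ℝ) b, dist (f u) (f v) = |u - v|) ∧
    s = f '' Set.Icc 0 b

/-- A geodesic metric space. -/
def GeodesicSpace (X : Type*) [MetricSpace X] : Prop :=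
  ∀ x y : X, ∃ s : Set X, IsGeodesicSegment s x y

/-- `X` is `δ`-hyperbolic: geodesic, and every geodesic triangle is `δ`-thin. -/
def DeltaHyperbolic (δ : ℝ) (X : Type*) [MetricSpace X] : Prop :=
  GeodesicSpace X ∧
    ∀ (x y z : X) (s₁ s₂ s₃ : Set X),
      IsGeodesicSegment s₁ x y → IsGeodesicSegment s₂ y z → IsGeodesicSegment s₃ x z →
      ∀ p ∈ s₁, ∃ q ∈ s₂ ∪ s₃, dist p q ≤ δ

/-- `A` is an `ε`-quasiconvex subset of `X`. -/
def Quasiconvex (ε : ℝ) (A : Set X) : Prop :=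
  ∀ x ∈ A, ∀ y ∈ A, ∀ s : Set X, IsGeodesicSegment s x y → ∀ p ∈ s, ∃ a ∈ A, dist p a ≤ ε

/-- The Gromov product `(y,z)_x`. -/
def gromov (x y z : X) : ℝ := (dist y x + dist z x - dist y z) / 2

def IsGeodesicRay (γ : ℝ → X) : Prop :=
  ∀ s t : ℝ, 0 ≤ s → 0 ≤ t → dist (γ s) (γ t) = |s - t|

def IsBiGeodesic (γ : ℝ → X) : Prop :=
  ∀ s t : ℝ, dist (γ s) (γ t) = |s - t|

/-- `A` and `B` are `K`-Hausdorff close. -/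
def HClose (K : ℝ) (A B : Set X) : Prop :=
  (∀ a ∈ A, ∃ b ∈ B, dist a b ≤ K) ∧ ∀ b ∈ B, ∃ a ∈ A, dist a b ≤ K

def HausdorffClose (A B : Set X) : Prop := ∃ K : ℝ, HClose K A B

/-- Two geodesic rays are asymptotic iff their images are Hausdorff close. -/
def Asymptotic (γ γ' : ℝ → X) : Prop :=
  HausdorffClose (γ '' Set.Ici 0) (γ' '' Set.Ici 0)

def GRay (X : Type*) [MetricSpace X] : Type _ := {γ : ℝ → X // IsGeodesicRay γ}

theorem asymptotic_refl (γ : ℝ → X) : Asymptotic γ γ :=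
  ⟨0, fun a ha => ⟨a, ha, by simp⟩, fun b hb => ⟨b, hb, by simp⟩⟩

theorem asymptotic_symm {γ γ' : ℝ → X} (h : Asymptotic γ γ') : Asymptotic γ' γ := by
  obtain ⟨K, h₁, h₂⟩ := h
  refine ⟨K, fun a ha => ?_, fun b hb => ?_⟩
  · obtain ⟨b, hb, hd⟩ := h₂ a ha
    exact ⟨b, hb, by rwa [dist_comm]⟩
  · obtain ⟨a, ha, hd⟩ := h₁ b hb
    exact ⟨a, ha, by rwa [dist_comm]⟩

theorem asymptotic_trans {γ₁ γ₂ γ₃ : ℝ → X} (h : Asymptotic γ₁ γ₂)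
    (h' : Asymptotic γ₂ γ₃) : Asymptotic γ₁ γ₃ := by
  obtain ⟨K, h₁, h₂⟩ := h
  obtain ⟨K', h₁', h₂'⟩ := h'
  refine ⟨K + K', fun a ha => ?_, fun c hc => ?_⟩
  · obtain ⟨b, hb, hab⟩ := h₁ a ha
    obtain ⟨c, hc, hbc⟩ := h₁' b hb
    exact ⟨c, hc, (dist_triangle a b c).trans (by linarith)⟩
  · obtain ⟨b, hb, hbc⟩ := h₂' c hc
    obtain ⟨a, ha, hab⟩ := h₂ b hb
    exact ⟨a, ha, (dist_triangle a b c).trans (by linarith)⟩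

def raySetoid (X : Type*) [MetricSpace X] : Setoid (GRay X) where
  r γ γ' := Asymptotic γ.1 γ'.1
  iseqv := ⟨fun γ => asymptotic_refl γ.1, fun h => asymptotic_symm h,
    fun h h' => asymptotic_trans h h'⟩

/-- The (geodesic) boundary of `X`: asymptoty classes of geodesic rays. -/
def Boundary (X : Type*) [MetricSpace X] : Type _ := Quotient (raySetoid X)

def Boundary.mk {X : Type*} [MetricSpace X] (γ : GRay X) : Boundary X :=
  Quotient.mk (raySetoid X) γ

/-- A strongly geodesic metric space. -/
def StronglyGeodesic (X : Type*) [MetricSpace X] : Prop :=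
  GeodesicSpace X ∧
  (∀ γ : ℝ → X, IsGeodesicRay γ → ∀ y : X,
      ∃ γ' : ℝ → X, IsGeodesicRay γ' ∧ γ' 0 = y ∧ Asymptotic γ γ') ∧
  (∀ γ₁ γ₂ : ℝ → X, IsGeodesicRay γ₁ → IsGeodesicRay γ₂ → γ₁ 0 = γ₂ 0 →
      ¬ Asymptotic γ₁ γ₂ →
      ∃ γ : ℝ → X, IsBiGeodesic γ ∧
        HausdorffClose (Set.range γ) (γ₁ '' Set.Ici 0 ∪ γ₂ '' Set.Ici 0)) ∧
  (∀ (x : X) (u : ℕ → X),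
      (∀ M : ℝ, ∃ N : ℕ, ∀ n, N ≤ n → ∀ m, N ≤ m → M ≤ gromov x (u n) (u m)) →
      ∃ γ : ℝ → X, IsGeodesicRay γ ∧ γ 0 = x ∧
        ∀ M : ℝ, ∃ N : ℕ, ∀ n, N ≤ n → ∀ m, N ≤ m → M ≤ gromov x (γ (n : ℝ)) (u m))

/-- The sequence `u` converges to the boundary point `p`, with basepoint `x`. -/
def SeqConvTo (x : X) (u : ℕ → X) (p : Boundary X) : Prop :=
  ∃ γ : GRay X, Boundary.mk γ = p ∧
    ∀ M : ℝ, ∃ N : ℕ, ∀ n, N ≤ n → ∀ m, N ≤ m → M ≤ gromov x (u n) (γ.1 (m : ℝ))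

/-- `γ` is a geodesic ray in the class of the boundary point `p`. -/
def RayTo (γ : ℝ → X) (p : Boundary X) : Prop :=
  ∃ h : IsGeodesicRay γ, Boundary.mk ⟨γ, h⟩ = p

/-- `γ` is a biinfinite geodesic whose two ends converge to `p` and `q`. -/
def BiGeodesicJoins (γ : ℝ → X) (p q : Boundary X) : Prop :=
  IsBiGeodesic γ ∧ SeqConvTo (γ 0) (fun n => γ (-(n : ℝ))) p ∧
    SeqConvTo (γ 0) (fun n => γ (n : ℝ)) q

/-- `s` is (the image of) a geodesic joining two points of `X ∪ ∂X`. -/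
def JoinSet : X ⊕ Boundary X → X ⊕ Boundary X → Set X → Prop
  | Sum.inl x, Sum.inl y, s => IsGeodesicSegment s x y
  | Sum.inl x, Sum.inr p, s => ∃ γ : ℝ → X, γ 0 = x ∧ RayTo γ p ∧ s = γ '' Set.Ici 0
  | Sum.inr p, Sum.inl x, s => ∃ γ : ℝ → X, γ 0 = x ∧ RayTo γ p ∧ s = γ '' Set.Ici 0
  | Sum.inr p, Sum.inr q, s => ∃ γ : ℝ → X, BiGeodesicJoins γ p q ∧ s = Set.range γ

/-- The convex hull `Conv(A)` of a subset `A ⊆ X ∪ ∂X`. -/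
def geoConv (A : Set (X ⊕ Boundary X)) : Set X :=
  {x | (∃ a : X, A = {Sum.inl a} ∧ x = a) ∨
    ∃ p ∈ A, ∃ q ∈ A, p ≠ q ∧ ∃ s : Set X, JoinSet p q s ∧ x ∈ s}

/-- The distance between two subsets of `X`. -/
def setDist (A B : Set X) : ℝ := sInf (Set.image2 dist A B)

/-- `a` is a projection of `p` on `A` (relative to `δ`). -/
def IsProjection (δ : ℝ) (A : Set X) (p a : X) : Prop :=
  a ∈ A ∧ ∀ a' ∈ A, dist p a ≤ dist p a' + δ

/-- `f` restricted to `[0,L]` is a unit-speed geodesic from `x` to `y`. -/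
def GeodParam (f : ℝ → X) (L : ℝ) (x y : X) : Prop :=
  0 ≤ L ∧ f 0 = x ∧ f L = y ∧
    ∀ u ∈ Set.Icc (0 : ℝ) L, ∀ v ∈ Set.Icc (0 : ℝ) L, dist (f u) (f v) = |u - v|

/-- Concatenation of three paths, the first on `[0,a]`, the second on `[0,b]`. -/
def concat3 (f₁ f₂ f₃ : ℝ → X) (a b : ℝ) : ℝ → X := fun t =>
  if t ≤ a then f₁ t else if t ≤ a + b then f₂ (t - a) else f₃ (t - a - b)

/-- `f` is a `(lam, ε)`-quasigeodesic on `[a,b]`. -/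
def QuasigeodesicOn (lam ε : ℝ) (f : ℝ → X) (a b : ℝ) : Prop :=
  ∀ s ∈ Set.Icc a b, ∀ t ∈ Set.Icc a b, |s - t| ≤ lam * dist (f s) (f t) + ε

/-- The action of `G` on `X` is by isometries. -/
def IsometricAction (G Y : Type*) [Group G] [MetricSpace Y] [MulAction G Y] : Prop :=
  ∀ (g : G) (x y : Y), dist (g • x) (g • y) = dist x y

section GroupAction

variable {G : Type*} [Group G]

/-- The limit set `Λ(U) ⊆ ∂X` of a subgroup `U ≤ G`. -/
def limitSet (X : Type*) [MetricSpace X] [MulAction G X] (U : Subgroup G) :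
    Set (Boundary X) :=
  {p | ∃ x₀ : X, ∃ u : ℕ → U, SeqConvTo x₀ (fun n => ((u n : G)) • x₀) p}

/-- The small displacement set `E(U)` (relative to `δ`). -/
def smallDispSet (X : Type*) [MetricSpace X] [MulAction G X] (δ : ℝ) (U : Subgroup G) :
    Set X :=
  {x | ∃ u : G, u ∈ U ∧ u ≠ 1 ∧ dist x (u • x) ≤ 100 * δ}

/-- `Z(U) = Conv(Λ(U) ∪ E(U))`. -/
def ZSet (X : Type*) [MetricSpace X] [MulAction G X] (δ : ℝ) (U : Subgroup G) : Set X :=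
  geoConv (Sum.inr '' limitSet X U ∪ Sum.inl '' smallDispSet X δ U)

/-- The convex hull `X(U)`: the closure of `Conv(Z(U))`. -/
def cHull (X : Type*) [MetricSpace X] [MulAction G X] (δ : ℝ) (U : Subgroup G) : Set X :=
  closure (geoConv (Sum.inl '' ZSet X δ U))

/-- The weak convex hull `X_U = Conv(Λ(U))`. -/
def weakHull (X : Type*) [MetricSpace X] [MulAction G X] (U : Subgroup G) : Set X :=
  geoConv (Sum.inr '' limitSet X U)

/-- `l_V(g) = d(X(V), gX(V))`. -/
def lV (X : Type*) [MetricSpace X] [MulAction G X] (δ : ℝ) (V : Subgroup G) (g : G) : ℝ :=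
  setDist (cHull X δ V) (g • cHull X δ V)

/-- The translation length of `g`. -/
def translationLength (X : Type*) [MetricSpace X] [MulAction G X] (g : G) : ℝ :=
  sInf (Set.range fun x : X => dist x (g • x))

/-- The asymptotic translation length of `g`. -/
def asympTranslationLength (X : Type*) [MetricSpace X] [MulAction G X] (g : G) : ℝ :=
  Filter.liminf (fun n : ℕ => translationLength X (g ^ n) / (n : ℝ)) Filter.atTop

/-- An elementary move between `G`-tuples `(U₁,…,U_n; h₁,…,h_m)`. -/
def gMove {n m : ℕ} (M M' : (Fin n → Subgroup G) × (Fin m → G)) : Prop :=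
  (M'.2 = M.2 ∧ ∃ (j : Fin n) (g : G),
      g ∈ Subgroup.closure (Set.range M.2 ∪ ⋃ i ∈ {i : Fin n | i ≠ j}, ((M.1 i : Set G))) ∧
      (∀ i, i ≠ j → M'.1 i = M.1 i) ∧
      M'.1 j = Subgroup.map (MulAut.conj g).toMonoidHom (M.1 j)) ∨
  (M'.1 = M.1 ∧ ∃ (i : Fin m) (g₁ g₂ : G),
      g₁ ∈ Subgroup.closure (M.2 '' {j : Fin m | j ≠ i} ∪ ⋃ t, ((M.1 t : Set G))) ∧
      g₂ ∈ Subgroup.closure (M.2 '' {j : Fin m | j ≠ i} ∪ ⋃ t, ((M.1 t : Set G))) ∧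
      (∀ j, j ≠ i → M'.2 j = M.2 j) ∧
      M'.2 i = g₁ * M.2 i * g₂)

/-- Equivalence of `G`-tuples: a finite chain of elementary moves. -/
def gEquiv {n m : ℕ} :
    (Fin n → Subgroup G) × (Fin m → G) → (Fin n → Subgroup G) × (Fin m → G) → Prop :=
  Relation.ReflTransGen gMove

/-- The family of factors `U₁,…,U_n, F(h₁),…,F(h_m)`. -/
def FF {n : ℕ} (m : ℕ) (U : Fin n → Subgroup G) : Fin n ⊕ Fin m → Type _
  | Sum.inl j => ↥(U j)
  | Sum.inr _ => FreeGroup PUnit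

instance ffGroup {n : ℕ} (m : ℕ) (U : Fin n → Subgroup G) :
    (i : Fin n ⊕ Fin m) → Group (FF m U i)
  | Sum.inl j => inferInstanceAs (Group ↥(U j))
  | Sum.inr _ => inferInstanceAs (Group (FreeGroup PUnit))

def ffHoms {n m : ℕ} (U : Fin n → Subgroup G) (H : Fin m → G) :
    (i : Fin n ⊕ Fin m) → FF m U i →* G
  | Sum.inl j => (U j).subtype
  | Sum.inr j => FreeGroup.lift fun _ => H j

/-- The canonical homomorphism `U₁ ∗ ⋯ ∗ U_n ∗ F(H) → G`. -/
def freeProdHom {n m : ℕ} (U : Fin n → Subgroup G) (H : Fin m → G) :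
    Monoid.CoprodI (FF m U) →* G :=
  Monoid.CoprodI.lift (ffHoms U H)

/-- `W = U₁ ∗ ⋯ ∗ U_n ∗ F(H)`: the canonical homomorphism is injective with image `W`. -/
def IsFreeProdDecomp {n m : ℕ} (U : Fin n → Subgroup G) (H : Fin m → G)
    (W : Subgroup G) : Prop :=
  Function.Injective (freeProdHom U H) ∧ (freeProdHom U H).range = W

/-- Minimality of the `G`-pair `(V; H)` (relative to a `1`-hyperbolic `G`-space `X`). -/
def PairMinimal (X : Type*) [MetricSpace X] [MulAction G X] {m : ℕ}
    (V : Subgroup G) (H : Fin m → G) : Prop :=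
  ∀ (V' : Subgroup G) (H' : Fin m → G),
    gEquiv ((fun _ : Fin 1 => V), H) ((fun _ : Fin 1 => V'), H') →
    (∑ i, lV X 1 V (H i)) ≤ (∑ i, lV X 1 V' (H' i)) + 1

/-- An elementary Nielsen move on tuples of elements of `G`. -/
def NielsenMove {k : ℕ} (g g' : Fin k → G) : Prop :=
  (∃ i : Fin k, (∀ j, j ≠ i → g' j = g j) ∧ g' i = (g i)⁻¹) ∨
  (∃ i j : Fin k, i ≠ j ∧ (∀ t, t ≠ i → g' t = g t) ∧ g' i = g i * g j) ∨
  (∃ i j : Fin k, i ≠ j ∧ g' = g ∘ Equiv.swap i j)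

/-- Nielsen equivalence: a finite chain of elementary Nielsen moves. -/
def NielsenEq {k : ℕ} : (Fin k → G) → (Fin k → G) → Prop :=
  Relation.ReflTransGen NielsenMove

/-- Word length of `g` with respect to the (symmetrized) generating set `S`. -/
def wordLength (S : Set G) (g : G) : ℕ :=
  sInf {n : ℕ | ∃ f : Fin n → G, (∀ i, f i ∈ S ∨ (f i)⁻¹ ∈ S) ∧ (List.ofFn f).prod = g}

/-- `(X, ι)` is a model of the Cayley graph `Γ(G,S)`. -/
def IsCayleyGraph (G : Type*) [Group G] (S : Set G) (X : Type*) [MetricSpace X]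
    [MulAction G X] (ι : G → X) : Prop :=
  IsometricAction G X ∧
  (∀ g h : G, ι (g * h) = g • ι h) ∧
  Function.Injective ι ∧
  GeodesicSpace X ∧
  (∀ g h : G, dist (ι g) (ι h) = (wordLength S (g⁻¹ * h) : ℝ)) ∧
  ∀ x : X, ∃ g h : G, wordLength S (g⁻¹ * h) ≤ 1 ∧
    ∃ s : Set X, IsGeodesicSegment s (ι g) (ι h) ∧ x ∈ s

/-- `H` is a quasiconvex subgroup (with respect to the Cayley graph model `(X, ι)`). -/
def QCSubgroup (X : Type*) [MetricSpace X] (ι : G → X) (H : Subgroup G) : Prop :=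
  ∃ ε : ℝ, 0 ≤ ε ∧ Quasiconvex ε (ι '' (H : Set G))

end GroupAction

/-- Every nontrivial element of finite order has finite centralizer. -/
def AlmostTorsionFree (G : Type*) [Group G] : Prop :=
  ∀ g : G, g ≠ 1 → IsOfFinOrder g → ((Subgroup.centralizer {g} : Subgroup G) : Set G).Finite

/-- `U` is nontrivial and admits no nontrivial free product decomposition. -/
def FreelyIndecomposable (U : Type*) [Group U] : Prop :=
  Nontrivial U ∧
    ¬ ∃ A B : Subgroup U, A ≠ ⊥ ∧ B ≠ ⊥ ∧
        Function.Bijective (Monoid.Coprod.lift A.subtype B.subtype)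

def InfiniteCyclic (U : Type*) [Group U] : Prop := Infinite U ∧ IsCyclic U

def VirtuallyCyclic (U : Type*) [Group U] : Prop :=
  ∃ H : Subgroup U, H.index ≠ 0 ∧ IsCyclic ↥H

def NonElementary (U : Type*) [Group U] : Prop := ¬ Finite U ∧ ¬ VirtuallyCyclic U

end KW

universe u v

namespace KW

open Metric Set

def FP (X : Type*) [MetricSpace X] : Prop := ∀ x y z w : X,
  dist x y + dist z w ≤ max (dist x z + dist y w) (dist x w + dist y z) + 4

def Geo (X : Type*) [MetricSpace X] : Prop := ∀ x y : X, ∃ γ, GeodParam γ (dist x y) x y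

section toolkit

variable {X : Type*} [MetricSpace X]

theorem GeodParam.left {γ : ℝ → X} {L : ℝ} {x y : X} (h : GeodParam γ L x y) {t : ℝ}
    (ht : t ∈ Icc 0 L) : dist x (γ t) = t := by
  have := h.2.2.2 0 ⟨le_refl _, h.1⟩ t ht
  rw [h.2.1] at this
  rw [this, zero_sub, abs_neg, abs_of_nonneg ht.1]

theorem GeodParam.right {γ : ℝ → X} {L : ℝ} {x y : X} (h : GeodParam γ L x y) {t : ℝ}
    (ht : t ∈ Icc 0 L) : dist (γ t) y = L - t := by
  have := h.2.2.2 t ht L ⟨h.1, le_refl _⟩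
  rw [h.2.2.1] at this
  rw [this, abs_sub_comm, abs_of_nonneg (by linarith [ht.2])]

theorem GeodParam.len {γ : ℝ → X} {L : ℝ} {x y : X} (h : GeodParam γ L x y) : dist x y = L := by
  have := h.right (t := 0) ⟨le_refl _, h.1⟩
  rwa [h.2.1, sub_zero] at this

theorem GeodParam.le {γ : ℝ → X} {L : ℝ} {x y : X} (h : GeodParam γ L x y) {s t : ℝ}
    (h0 : 0 ≤ s) (hst : s ≤ t) (h1 : t ≤ L) : dist (γ s) (γ t) = t - s := by
  rw [h.2.2.2 s ⟨h0, hst.trans h1⟩ t ⟨h0.trans hst, h1⟩, abs_sub_comm, abs_of_nonneg (by linarith)]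

theorem GeodParam.sub {γ : ℝ → X} {L : ℝ} {x y : X} (h : GeodParam γ L x y) {s t : ℝ}
    (h0 : 0 ≤ s) (hst : s ≤ t) (h1 : t ≤ L) :
    GeodParam (fun r => γ (s + r)) (t - s) (γ s) (γ t) := by
  refine ⟨by linarith, by simp, by simp, ?_⟩
  intro u hu v hv
  rw [h.2.2.2 (s + u) ⟨by linarith [hu.1], by linarith [hu.2]⟩ (s + v)
    ⟨by linarith [hv.1], by linarith [hv.2]⟩]
  congr 1; ring

theorem GeodParam.rev {γ : ℝ → X} {L : ℝ} {x y : X} (h : GeodParam γ L x y) :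
    GeodParam (fun r => γ (L - r)) L y x := by
  refine ⟨h.1, by simpa using h.2.2.1, by simpa using h.2.1, ?_⟩
  intro u hu v hv
  rw [h.2.2.2 (L - u) ⟨by linarith [hu.2], by linarith [hu.1]⟩ (L - v)
    ⟨by linarith [hv.2], by linarith [hv.1]⟩, abs_sub_comm]
  congr 1; ring

theorem GeodParam.continuousOn {γ : ℝ → X} {L : ℝ} {x y : X} (h : GeodParam γ L x y) :
    ContinuousOn γ (Icc 0 L) := by
  refine Metric.continuousOn_iff.2 fun b hb ε hε => ⟨ε, hε, fun a ha hab => ?_⟩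
  rw [h.2.2.2 a ha b hb]
  rwa [Real.dist_eq] at hab

theorem GeodParam.seg {γ : ℝ → X} {L : ℝ} {x y : X} (h : GeodParam γ L x y) :
    IsGeodesicSegment (γ '' Icc 0 L) x y :=
  ⟨L, γ, h.1, h.2.1, h.2.2.1, h.2.2.2, rfl⟩

theorem geo_of_geodesicSpace (h : GeodesicSpace X) : Geo X := by
  intro x y
  obtain ⟨s, b, f, hb, h0, h1, hi, hs⟩ := h x y
  have : GeodParam f b x y := ⟨hb, h0, h1, hi⟩
  refine ⟨f, ?_⟩
  rwa [this.len]

theorem insize (hX : DeltaHyperbolic 1 X) {γ : ℝ → X} {L : ℝ} {x y : X} (h : GeodParam γ L x y)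
    (z : X) {ε : ℝ} (hε : 0 < ε) :
    ∃ τ ∈ Icc 0 L, τ + dist (γ τ) z ≤ dist x z + 2 + ε ∧
      L - τ + dist (γ τ) z ≤ dist y z + 2 + ε := by
  obtain ⟨α, hα⟩ := geo_of_geodesicSpace hX.1 x z
  obtain ⟨β, hβ⟩ := geo_of_geodesicSpace hX.1 y z
  set s3 := α '' Icc 0 (dist x z) with hs3
  set s2 := β '' Icc 0 (dist y z) with hs2
  have hx3 : x ∈ s3 := ⟨0, ⟨le_refl _, hα.1⟩, hα.2.1⟩
  have hy2 : y ∈ s2 := ⟨0, ⟨le_refl _, hβ.1⟩, hβ.2.1⟩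
  have hcont : ContinuousOn (fun τ => infDist (γ τ) s3 - infDist (γ τ) s2) (Icc 0 L) :=
    ((continuous_infDist_pt s3).comp_continuousOn h.continuousOn).sub
      ((continuous_infDist_pt s2).comp_continuousOn h.continuousOn)
  have hivt := intermediate_value_Icc h.1 hcont
  have h0 : (0 : ℝ) ∈ Icc ((fun τ => infDist (γ τ) s3 - infDist (γ τ) s2) 0)
      ((fun τ => infDist (γ τ) s3 - infDist (γ τ) s2) L) := by
    constructor
    · simp only [h.2.1, infDist_zero_of_mem hx3]
      linarith [infDist_nonneg (x := x) (s := s2)]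
    · simp only [h.2.2.1, infDist_zero_of_mem hy2]
      linarith [infDist_nonneg (x := y) (s := s3)]
  obtain ⟨τ, hτ, he⟩ := hivt h0
  have he' : infDist (γ τ) s3 = infDist (γ τ) s2 := by
    simp only at he; linarith
  obtain ⟨q, hq, hqd⟩ := hX.2 x y z _ s2 s3 h.seg hβ.seg hα.seg (γ τ) ⟨τ, hτ, rfl⟩
  have h3 : infDist (γ τ) s3 ≤ 1 := by
    rcases hq with hq | hq
    · rw [he']; exact (infDist_le_dist_of_mem hq).trans hqd
    · exact (infDist_le_dist_of_mem hq).trans hqd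
  have h2 : infDist (γ τ) s2 ≤ 1 := he' ▸ h3
  have aux : ∀ (w : X) (δ : ℝ → X), GeodParam δ (dist w z) w z →
      infDist (γ τ) (δ '' Icc 0 (dist w z)) ≤ 1 →
      dist w (γ τ) + dist (γ τ) z ≤ dist w z + 2 + ε := by
    intro w δ hδ hi
    have hne : (δ '' Icc 0 (dist w z)).Nonempty := ⟨_, 0, ⟨le_refl _, hδ.1⟩, rfl⟩
    obtain ⟨q, ⟨r, hr, rfl⟩, hd⟩ := (infDist_lt_iff (x := γ τ) hne (r := 1 + ε / 2)).1 (by linarith)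
    have e1 := hδ.left hr
    have e2 := hδ.right hr
    have t1 := dist_triangle w (δ r) (γ τ)
    have t2 := dist_triangle (γ τ) (δ r) z
    rw [dist_comm (δ r)] at t1
    linarith
  have a1 := aux x α hα h3
  have a2 := aux y β hβ h2
  rw [h.left hτ] at a1
  rw [dist_comm, h.right hτ] at a2
  exact ⟨τ, hτ, a1, a2⟩

theorem fp_of_hyp (hX : DeltaHyperbolic 1 X) : FP X := by
  intro x y z w
  refine le_of_forall_pos_le_add fun ε hε => ?_
  obtain ⟨γ, h⟩ := geo_of_geodesicSpace hX.1 x y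
  obtain ⟨τ, hτ, a1, a2⟩ := insize hX h z (half_pos hε)
  obtain ⟨σ, hσ, b1, b2⟩ := insize hX h w (half_pos hε)
  have t1 := dist_triangle4 z (γ τ) (γ σ) w
  rw [dist_comm z (γ τ)] at t1
  rcases le_total τ σ with hle | hle
  · rw [h.le hτ.1 hle hσ.2] at t1
    have := le_max_right (dist x z + dist y w) (dist x w + dist y z)
    linarith
  · rw [dist_comm (γ τ) (γ σ), h.le hσ.1 hle hτ.2] at t1
    have := le_max_left (dist x z + dist y w) (dist x w + dist y z)
    linarith

/-- disjunctive form of the four point condition -/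
theorem FP.or (h : FP X) (x y z w : X) :
    dist x y + dist z w ≤ dist x z + dist y w + 4 ∨
    dist x y + dist z w ≤ dist x w + dist y z + 4 := by
  have := h x y z w
  rcases le_total (dist x z + dist y w) (dist x w + dist y z) with h1 | h1
  · rw [max_eq_right h1] at this; exact Or.inr this
  · rw [max_eq_left h1] at this; exact Or.inl this

/-- Lemma N -/
theorem near (hfp : FP X) {γ : ℝ → X} {L : ℝ} {p q : X} (h : GeodParam γ L p q) (w : X) :
    ∃ τ ∈ Icc 0 L, dist w (γ τ) ≤ (dist w p + dist w q - L) / 2 + 4 := by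
  have hL := h.len
  have t1 := dist_triangle p w q
  have t2 := dist_triangle w p q
  have t3 := dist_triangle w q p
  rw [dist_comm p w] at t1
  rw [dist_comm q p] at t3
  have hr : (dist w p - dist w q + L) / 2 ∈ Icc 0 L := ⟨by linarith, by linarith⟩
  refine ⟨_, hr, ?_⟩
  have e1 := h.left hr
  have e2 := h.right hr
  set u := γ ((dist w p - dist w q + L) / 2)
  rcases hfp.or p q w u with h' | h'
  · rw [dist_comm q u, dist_comm p w] at h'; linarith
  · rw [dist_comm q w] at h'; linarith

end toolkit
end KW

namespace KW

open Metric Set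

section toolkit2

variable {X : Type*} [MetricSpace X]

/-- Lemma A1 -/
theorem quadA1 (hfp : FP X) {x y u o1 o2 : X} {e Hh L : ℝ} {γ : ℝ → X}
    (hu : dist x u + dist u y ≤ dist x y + 2 * e) (h1 : dist x o1 ≤ Hh) (h2 : dist y o2 ≤ Hh)
    (hγ : GeodParam γ L o1 o2) :
    dist u o1 ≤ Hh - dist u x + 2 * e + 8 ∨ dist u o2 ≤ Hh - dist u y + 2 * e + 8 ∨
    ∃ τ ∈ Icc 0 L, dist u (γ τ) ≤ e + 8 := by
  have hL := hγ.len
  have c1 := dist_comm x u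
  have c2 := dist_comm y u
  have c3 := dist_comm o1 u
  rcases hfp.or x y u o1 with h | h
  · rcases hfp.or y o1 u o2 with h' | h'
    · right; right
      obtain ⟨τ, hτ, hd⟩ := near hfp hγ u
      exact ⟨τ, hτ, by linarith⟩
    · right; left; linarith
  · left; linarith

/-- points of geodesics between points of `O` regularly come `μ`-close to `O` -/
def Dip (O : Set X) (μ T : ℝ) : Prop :=
  ∀ (γ : ℝ → X) (L : ℝ) (o o' : X), o ∈ O → o' ∈ O → GeodParam γ L o o' →
    ∀ τ1 τ2 : ℝ, 0 ≤ τ1 → τ1 + T ≤ τ2 → τ2 ≤ L → ∃ τ ∈ Icc τ1 τ2, infDist (γ τ) O ≤ μ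

theorem Dip.mono {O : Set X} {μ μ' T : ℝ} (h : Dip O μ T) (hμ : μ ≤ μ') : Dip O μ' T := by
  intro γ L o o' ho ho' hγ τ1 τ2 a b c
  obtain ⟨τ, hτ, hd⟩ := h γ L o o' ho ho' hγ τ1 τ2 a b c
  exact ⟨τ, hτ, hd.trans hμ⟩

theorem infDist_le_add {O : Set X} {x y : X} : infDist x O ≤ infDist y O + dist x y :=
  infDist_le_infDist_add_dist

theorem Dip.all {O : Set X} {μ T : ℝ} (h : Dip O μ T) (hμ : 0 ≤ μ) (hT : 0 ≤ T)
    {γ : ℝ → X} {L : ℝ} {o o' : X} (ho : o ∈ O) (ho' : o' ∈ O) (hγ : GeodParam γ L o o')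
    {τ : ℝ} (hτ : τ ∈ Icc 0 L) : infDist (γ τ) O ≤ μ + T := by
  by_cases hc : τ + T ≤ L
  · obtain ⟨σ, hσ, hd⟩ := h γ L o o' ho ho' hγ τ (τ + T) hτ.1 le_rfl hc
    have := infDist_le_add (O := O) (x := γ τ) (y := γ σ)
    rw [hγ.le hτ.1 hσ.1 (hσ.2.trans hc)] at this
    linarith [hσ.2]
  · have := infDist_le_dist_of_mem (x := γ τ) ho'
    rw [hγ.right hτ] at this
    linarith

theorem exists_close {O : Set X} (hO : O.Nonempty) {x : X} {r : ℝ} (h : infDist x O < r) :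
    ∃ o ∈ O, dist x o ≤ r := by
  obtain ⟨o, ho, hd⟩ := (infDist_lt_iff hO).1 h
  exact ⟨o, ho, hd.le⟩

/-- Lemma Q -/
theorem lemQ (hfp : FP X) (hgeo : Geo X) {O : Set X} (hO : O.Nonempty) {l c T e : ℝ}
    (hT : 0 ≤ T) (hdip : Dip O (l / 2 - c) T) {x y u1 u2 : X}
    (hx : infDist x O ≤ l / 2 + 1) (hy : infDist y O ≤ l / 2 + 1)
    (hu1 : dist x u1 + dist u1 y ≤ dist x y + 2 * e)
    (hu2 : dist x u2 + dist u2 y ≤ dist x y + 2 * e)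
    (h1x : c + 2 * e + 10 ≤ dist u1 x) (h1y : c + 2 * e + 10 ≤ dist u1 y)
    (h2x : c + 2 * e + 10 ≤ dist u2 x) (h2y : c + 2 * e + 10 ≤ dist u2 y)
    (h12 : T + 2 * e + 16 ≤ dist u1 u2) (he : 0 ≤ e) :
    ∃ u, infDist u O ≤ l / 2 - c ∧ dist u1 u + dist u u2 ≤ dist u1 u2 + 4 * e + 32 := by
  obtain ⟨o1, ho1, hd1⟩ := exists_close hO (show infDist x O < l / 2 + 2 by linarith)
  obtain ⟨o2, ho2, hd2⟩ := exists_close hO (show infDist y O < l / 2 + 2 by linarith)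
  obtain ⟨γ, hγ⟩ := hgeo o1 o2
  rcases quadA1 hfp hu1 hd1 hd2 hγ with h | h | ⟨τ, hτ, h⟩
  · exact ⟨u1, (infDist_le_dist_of_mem ho1).trans (by linarith), by rw [dist_self]; linarith⟩
  · exact ⟨u1, (infDist_le_dist_of_mem ho2).trans (by linarith), by rw [dist_self]; linarith⟩
  rcases quadA1 hfp hu2 hd1 hd2 hγ with h' | h' | ⟨σ, hσ, h'⟩
  · exact ⟨u2, (infDist_le_dist_of_mem ho1).trans (by linarith), by rw [dist_self]; linarith⟩
  · exact ⟨u2, (infDist_le_dist_of_mem ho2).trans (by linarith), by rw [dist_self]; linarith⟩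
  have t4 := dist_triangle4 u1 (γ τ) (γ σ) u2
  have t5 := dist_triangle4 (γ τ) u1 u2 (γ σ)
  have c1 := dist_comm u2 (γ σ)
  have c2 := dist_comm u1 (γ τ)
  rcases le_total τ σ with hle | hle
  · have hd := hγ.le hτ.1 hle hσ.2
    obtain ⟨ρ, hρ, hr⟩ := hdip γ _ o1 o2 ho1 ho2 hγ τ σ hτ.1 (by linarith) hσ.2
    refine ⟨γ ρ, hr, ?_⟩
    have e1 := hγ.le hτ.1 hρ.1 (hρ.2.trans hσ.2)
    have e2 := hγ.le (hτ.1.trans hρ.1) hρ.2 hσ.2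
    have t1 := dist_triangle u1 (γ τ) (γ ρ)
    have t2 := dist_triangle (γ ρ) (γ σ) u2
    linarith
  · have hd := hγ.le hσ.1 hle hτ.2
    rw [dist_comm] at hd
    obtain ⟨ρ, hρ, hr⟩ := hdip γ _ o1 o2 ho1 ho2 hγ σ τ hσ.1 (by linarith) hτ.2
    refine ⟨γ ρ, hr, ?_⟩
    have e1 := hγ.le hσ.1 hρ.1 (hρ.2.trans hτ.2)
    have e2 := hγ.le (hσ.1.trans hρ.1) hρ.2 hτ.2
    have t1 := dist_triangle u1 (γ τ) (γ ρ)
    have t2 := dist_triangle (γ ρ) (γ σ) u2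
    have c3 := dist_comm (γ τ) (γ ρ)
    have c4 := dist_comm (γ σ) (γ ρ)
    linarith

theorem qcPt (hfp : FP X) (hgeo : Geo X) {O : Set X} (hO : O.Nonempty) {l T : ℝ}
    (hT : 0 ≤ T) (hl : 0 ≤ l) (hdip : Dip O (l / 2) T) {x y u : X}
    (hx : infDist x O ≤ l / 2 + 1) (hy : infDist y O ≤ l / 2 + 1)
    (hu : dist x u + dist u y ≤ dist x y) :
    infDist u O ≤ l / 2 + T + 10 := by
  obtain ⟨o1, ho1, hd1⟩ := exists_close hO (show infDist x O < l / 2 + 2 by linarith)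
  obtain ⟨o2, ho2, hd2⟩ := exists_close hO (show infDist y O < l / 2 + 2 by linarith)
  obtain ⟨γ, hγ⟩ := hgeo o1 o2
  rcases quadA1 hfp (e := 0) (u := u) (by linarith) hd1 hd2 hγ with h | h | ⟨τ, hτ, h⟩
  · have := infDist_le_dist_of_mem (x := u) ho1
    linarith [dist_nonneg (x := u) (y := x)]
  · have := infDist_le_dist_of_mem (x := u) ho2
    linarith [dist_nonneg (x := u) (y := y)]
  · have := hdip.all (by linarith) hT ho1 ho2 hγ hτ
    have := infDist_le_add (O := O) (x := u) (y := γ τ)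
    linarith

/-- Lemma A : product bound -/
theorem lemA (hfp : FP X) (hgeo : Geo X) {P Q : Set X} (hP : P.Nonempty) (hQ : Q.Nonempty)
    {l T T0 R' : ℝ} (hl : 0 ≤ l) (hT : 0 ≤ T) (hT0 : 0 ≤ T0)
    (hdP : Dip P (l / 2 - (T0 + 40)) T) (hdQ : Dip Q (l / 2) T0)
    (hsum : ∀ u, l - 1 ≤ infDist u P + infDist u Q) {x y M : X}
    (hMP : infDist M P ≤ l / 2 + 1) (hMQ : infDist M Q ≤ l / 2 + 1)
    (hx : infDist x P ≤ l / 2 + 1) (hy : infDist y Q ≤ l / 2 + 1)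
    (hR : 2 * (T0 + T + 66) ≤ R') (hxM : R' ≤ dist x M) (hyM : R' ≤ dist M y) :
    dist x M + dist M y ≤ dist x y + 2 * (T0 + T + 66) := by
  by_contra hcon
  push Not at hcon
  obtain ⟨α, hα⟩ := hgeo M x
  obtain ⟨β, hβ⟩ := hgeo M y
  have cx := dist_comm x M
  set s1 := T0 + 50 with hs1
  set s2 := T0 + T + 66 with hs2
  have m1 : s1 ∈ Icc 0 (dist M x) := ⟨by linarith, by linarith⟩
  have m2 : s2 ∈ Icc 0 (dist M x) := ⟨by linarith, by linarith⟩
  have l1 := hα.left m1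
  have l2 := hα.left m2
  have r1 := hα.right m1
  have r2 := hα.right m2
  have d12 := hα.le m1.1 (show s1 ≤ s2 by linarith) m2.2
  have c1 := dist_comm (α s1) M
  have c2 := dist_comm (α s2) M
  obtain ⟨u, hu, hud⟩ := lemQ hfp hgeo hP (e := 0) hT hdP (x := M) (y := x) (u1 := α s1) (u2 := α s2)
    hMP hx (by linarith) (by linarith) (by linarith) (by linarith) (by linarith) (by linarith)
    (by linarith) le_rfl
  obtain ⟨r, hr, hrd⟩ := near hfp (hα.sub m1.1 (show s1 ≤ s2 by linarith) m2.2) u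
  have cu := dist_comm u (α s1)
  set s := s1 + r with hs
  have hrs : s ≤ s2 := by linarith [hr.2]
  have ms : s ∈ Icc 0 (dist M x) := ⟨by linarith [hr.1], by linarith⟩
  have ms' : s ∈ Icc 0 (dist M y) := ⟨by linarith [hr.1], by linarith⟩
  have ls := hα.left ms
  have rs := hα.right ms
  have ls' := hβ.left ms'
  have rs' := hβ.right ms'
  have d1 : dist (α s) y ≤ dist M y - s + 4 := by
    rcases hfp.or M x (α s) y with h | h
    · linarith
    · have := dist_comm x (α s); linarith
  have d2 : dist (α s) (β s) ≤ 8 := by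
    rcases hfp.or M y (α s) (β s) with h | h
    · have := dist_comm y (β s); linarith
    · have := dist_comm y (α s); linarith
  have q1 := qcPt hfp hgeo hQ hT0 hl hdQ (x := M) (y := y) (u := β s) hMQ hy (by linarith)
  have i1 := infDist_le_add (O := Q) (x := α s) (y := β s)
  have i2 := infDist_le_add (O := P) (x := α s) (y := u)
  have cc := dist_comm u (α s)
  have := hsum (α s)
  linarith

end toolkit2
end KW

namespace KW

open Metric Set

section toolkit3

variable {X : Type*} [MetricSpace X]

/-- local chain conditions -/
structure Chain (x : ℕ → X) (N : ℕ) (C R' : ℝ) : Prop where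
  hd : ∀ i, i + 1 ≤ N → R' ≤ dist (x i) (x (i + 1))
  hg : ∀ i, i + 2 ≤ N → dist (x i) (x (i + 1)) + dist (x (i + 1)) (x (i + 2))
    ≤ dist (x i) (x (i + 2)) + 2 * C

theorem Chain.shift {x : ℕ → X} {N : ℕ} {C R' : ℝ} (h : Chain x N C R') (a : ℕ) :
    Chain (fun i => x (a + i)) (N - a) C R' := by
  refine ⟨fun i hi => ?_, fun i hi => ?_⟩
  · exact h.hd (a + i) (by omega)
  · exact h.hg (a + i) (by omega)

theorem Chain.rev {x : ℕ → X} {N : ℕ} {C R' : ℝ} (h : Chain x N C R') :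
    Chain (fun i => x (N - i)) N C R' := by
  refine ⟨fun i hi => ?_, fun i hi => ?_⟩
  · have := h.hd (N - (i + 1)) (by omega)
    rw [show N - (i + 1) + 1 = N - i by omega] at this
    rwa [dist_comm]
  · have := h.hg (N - (i + 2)) (by omega)
    rw [show N - (i + 2) + 1 = N - (i + 1) by omega,
      show N - (i + 2) + 2 = N - i by omega] at this
    have c1 := dist_comm (x (N - i)) (x (N - (i + 1)))
    have c2 := dist_comm (x (N - i)) (x (N - (i + 2)))
    have c3 := dist_comm (x (N - (i + 1))) (x (N - (i + 2)))
    linarith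

theorem Chain.fwd (hfp : FP X) {x : ℕ → X} {N : ℕ} {C R' : ℝ} (hC : 0 ≤ C)
    (hR : 2 * C + 7 ≤ R') (h : Chain x N C R') (j : ℕ) (hj : j + 1 ≤ N) :
    R' ≤ dist (x 0) (x (j + 1)) ∧
    dist (x 0) (x j) + dist (x j) (x (j + 1)) ≤ dist (x 0) (x (j + 1)) + 2 * C + 4 := by
  induction j with
  | zero =>
    refine ⟨h.hd 0 hj, ?_⟩
    simp only [dist_self, zero_add]; linarith
  | succ j ih =>
    obtain ⟨i1, i2⟩ := ih (by omega)
    have g := h.hg j (by omega)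
    have d1 := h.hd j (by omega)
    have d2 := h.hd (j + 1) (by omega)
    rw [show j + 1 + 1 = j + 2 by omega] at *
    have c := dist_comm (x j) (x (j + 1))
    have key : dist (x 0) (x (j + 1)) + dist (x (j + 1)) (x (j + 2)) ≤
        dist (x 0) (x (j + 2)) + 2 * C + 4 := by
      rcases hfp.or (x 0) (x (j + 1)) (x j) (x (j + 2)) with h' | h'
      · linarith
      · linarith
    exact ⟨by linarith, key⟩

theorem Chain.pair (hfp : FP X) {x : ℕ → X} {N : ℕ} {C R' : ℝ} (hC : 0 ≤ C)
    (hR : 2 * C + 7 ≤ R') (h : Chain x N C R') {i j : ℕ} (hij : i < j) (hj : j ≤ N) :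
    R' ≤ dist (x i) (x j) := by
  have := ((h.shift i).fwd hfp hC hR (j - i - 1) (by omega)).1
  simpa [show i + (j - i - 1 + 1) = j by omega] using this

theorem Chain.mid (hfp : FP X) {x : ℕ → X} {N : ℕ} {C R' : ℝ} (hC : 0 ≤ C)
    (hR : 2 * C + 7 ≤ R') (h : Chain x N C R') {j : ℕ} (hj : j ≤ N) :
    dist (x 0) (x j) + dist (x j) (x N) ≤ dist (x 0) (x N) + 2 * C + 8 := by
  rcases Nat.lt_or_ge j N with hj' | hj'
  · have f := (h.fwd hfp hC hR j (by omega)).2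
    have b := (h.rev.fwd hfp hC hR (N - (j + 1)) (by omega)).2
    simp only [Nat.sub_zero, show N - (N - (j + 1)) = j + 1 by omega,
      show N - (N - (j + 1) + 1) = j by omega] at b
    have d := h.hd j (by omega)
    have c1 := dist_comm (x N) (x (j + 1))
    have c2 := dist_comm (x N) (x j)
    have c3 := dist_comm (x j) (x (j + 1))
    rcases hfp.or (x 0) (x (j + 1)) (x j) (x N) with h' | h'
    · linarith
    · linarith
  · obtain rfl : j = N := le_antisymm hj hj'
    simp only [dist_self]; linarith

theorem cross {f : ℕ → ℝ} {N : ℕ} {a : ℝ} (h0 : f 0 < a) (hN : a ≤ f N) :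
    ∃ i, i + 1 ≤ N ∧ f i < a ∧ a ≤ f (i + 1) := by
  induction N with
  | zero => linarith
  | succ N ih =>
    by_cases h : a ≤ f N
    · obtain ⟨i, hi, h1, h2⟩ := ih h
      exact ⟨i, by omega, h1, h2⟩
    · exact ⟨N, le_rfl, not_le.1 h, hN⟩

/-- constants for U2 -/
def cHat (c C : ℝ) : ℝ := c + 4 * (C + 8) + 20
def cB (c C T : ℝ) : ℝ := 2 * (cHat c C + 5 * (C + 8) + 10) + T + 4 * (C + 8) + 16

theorem lemU2 (hfp : FP X) (hgeo : Geo X) {x : ℕ → X} {N : ℕ} {C R' : ℝ} (hC : 0 ≤ C)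
    (hR : 2 * C + 7 ≤ R') (h : Chain x N C R') {P : ℕ → Set X} {O' : Set X} {l c T : ℝ}
    (hc : 0 ≤ c) (hT : 0 ≤ T)
    (hP0 : ∀ i, i + 1 ≤ N → (P i).Nonempty) (hPO : ∀ i, i + 1 ≤ N → P i ⊆ O')
    (hP1 : ∀ i, i + 1 ≤ N → infDist (x i) (P i) ≤ l / 2 + 1)
    (hP2 : ∀ i, i + 1 ≤ N → infDist (x (i + 1)) (P i) ≤ l / 2 + 1)
    (hdip : ∀ i, i + 1 ≤ N → Dip (P i) (l / 2 - cHat c C) T)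
    (hR2 : 3 * cB c C T + 2 * (C + 8) < R')
    {γ : ℝ → X} {L : ℝ} (hγ : GeodParam γ L (x 0) (x N)) {τ1 τ2 : ℝ} (h1 : 0 ≤ τ1)
    (h12 : τ1 + 4 * cB c C T ≤ τ2) (h2 : τ2 ≤ L) :
    ∃ τ ∈ Icc τ1 τ2, infDist (γ τ) O' ≤ l / 2 - c := by
  have hL := hγ.len
  set K := C + 8 with hK
  set B := cB c C T with hB
  have hBd : B = 2 * (cHat c C + 5 * K + 10) + T + 4 * K + 16 := rfl
  have hch : cHat c C = c + 4 * K + 20 := rfl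
  set B1 := cHat c C + 5 * K + 10 with hB1
  have hproj : ∀ j, ∃ t ∈ Icc 0 L, (j ≤ N → dist (x j) (γ t) ≤ K) ∧ (j = 0 → t = 0) ∧
      (0 < N → j = N → t = L) := by
    intro j
    by_cases hj0 : j = 0
    · exact ⟨0, ⟨le_rfl, hγ.1⟩, fun _ => by rw [hj0, hγ.2.1, dist_self]; linarith, fun _ => rfl,
        fun a b => by omega⟩
    by_cases hjN : j = N
    · exact ⟨L, ⟨hγ.1, le_rfl⟩, fun _ => by rw [hjN, hγ.2.2.1, dist_self]; linarith,
        fun a => by omega, fun _ _ => rfl⟩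
    by_cases hjN' : j ≤ N
    · obtain ⟨t, ht, hd⟩ := near hfp hγ (x j)
      have := h.mid hfp hC hR hjN'
      rw [dist_comm (x j) (x 0)] at hd
      exact ⟨t, ht, fun _ => by linarith, fun a => by omega, fun _ b => by omega⟩
    · exact ⟨0, ⟨le_rfl, hγ.1⟩, fun a => by omega, fun _ => rfl, fun a b => by omega⟩
  choose t ht htd ht0 htN using hproj
  have hBpos : 0 < B := by linarith
  have hNpos : 0 < N := by
    rcases Nat.eq_zero_or_pos N with h0 | h0
    · exfalso; rw [h0, dist_self] at hL; linarith
    · exact h0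
  have core : ∀ θ i, i + 1 ≤ N → t i ≤ θ → θ + B ≤ t (i + 1) → τ1 ≤ θ → θ + B ≤ τ2 →
      ∃ τ ∈ Icc τ1 τ2, infDist (γ τ) O' ≤ l / 2 - c := by
    intro θ i hi hti htj hθ1 hθ2
    have hL2 := (ht (i + 1)).2
    have h0i := (ht i).1
    have di := htd i (by omega)
    have dj := htd (i + 1) hi
    have onpt : ∀ s, t i ≤ s → s ≤ t (i + 1) →
        dist (x i) (γ s) + dist (γ s) (x (i + 1)) ≤ dist (x i) (x (i + 1)) + 2 * (2 * K) ∧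
        s - t i - K ≤ dist (γ s) (x i) ∧ t (i + 1) - s - K ≤ dist (γ s) (x (i + 1)) := by
      intro s hs1 hs2
      have e1 := hγ.le h0i hs1 (hs2.trans hL2)
      have e2 := hγ.le (h0i.trans hs1) hs2 hL2
      have e3 := hγ.le h0i (hs1.trans hs2) hL2
      have a1 := dist_triangle (x i) (γ (t i)) (γ s)
      have a2 := dist_triangle (γ s) (γ (t (i + 1))) (x (i + 1))
      have a3 := dist_triangle4 (γ (t i)) (x i) (x (i + 1)) (γ (t (i + 1)))
      have a4 := dist_triangle (γ (t i)) (x i) (γ s)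
      have a5 := dist_triangle (γ s) (x (i + 1)) (γ (t (i + 1)))
      have c1 := dist_comm (γ (t (i + 1))) (x (i + 1))
      have c2 := dist_comm (γ (t i)) (x i)
      have c3 := dist_comm (γ s) (x i)
      exact ⟨by linarith, by linarith, by linarith⟩
    obtain ⟨p1, p2, p3⟩ := onpt (θ + B1) (by linarith) (by linarith)
    obtain ⟨q1, q2, q3⟩ := onpt (θ + B - B1) (by linarith) (by linarith)
    have dd := hγ.le (s := θ + B1) (t := θ + B - B1) (by linarith) (by linarith) (by linarith)
    obtain ⟨u, hu, hud⟩ := lemQ hfp hgeo (hP0 i hi) (e := 2 * K) hT (hdip i hi) (hP1 i hi)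
      (hP2 i hi) p1 q1 (by linarith) (by linarith) (by linarith) (by linarith) (by linarith)
      (by linarith)
    obtain ⟨r, hr, hrd⟩ := near hfp (hγ.sub (s := θ + B1) (t := θ + B - B1) (by linarith)
      (by linarith) (by linarith)) u
    have cu := dist_comm u (γ (θ + B1))
    refine ⟨θ + B1 + r, ⟨by linarith [hr.1], by linarith [hr.2]⟩, ?_⟩
    have i1 := infDist_le_add (O := P i) (x := γ (θ + B1 + r)) (y := u)
    have i2 := infDist_le_infDist_of_subset (x := γ (θ + B1 + r)) (hPO i hi) (hP0 i hi)
    have cc := dist_comm u (γ (θ + B1 + r))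
    linarith
  have t0 := ht0 0 rfl
  have tN := htN N hNpos rfl
  obtain ⟨i, hi, hi1, hi2⟩ := cross (f := t) (N := N) (a := τ1 + B) (by linarith) (by linarith)
  by_cases ci : τ1 + 2 * B ≤ t (i + 1)
  · exact core (τ1 + B) i hi hi1.le (by linarith) (by linarith) (by linarith)
  obtain ⟨j, hj, hj1, hj2⟩ := cross (f := t) (N := N) (a := τ1 + 3 * B) (by linarith) (by linarith)
  by_cases cj : τ1 + 4 * B ≤ t (j + 1)
  · exact core (τ1 + 3 * B) j hj hj1.le (by linarith) (by linarith) (by linarith)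
  exfalso
  push Not at ci cj
  have hle : t (i + 1) ≤ t (j + 1) := by linarith
  have e := hγ.le (ht (i + 1)).1 hle (ht (j + 1)).2
  have d1 := htd (i + 1) hi
  have d2 := htd (j + 1) hj
  have tr := dist_triangle4 (x (i + 1)) (γ (t (i + 1))) (γ (t (j + 1))) (x (j + 1))
  have c1 := dist_comm (γ (t (j + 1))) (x (j + 1))
  rcases lt_trichotomy (i + 1) (j + 1) with hlt | heq | hlt
  · have := h.pair hfp hC hR hlt hj
    linarith
  · rw [heq] at ci hi2; linarith
  · have := h.pair hfp hC hR hlt hi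
    rw [dist_comm] at this
    linarith

end toolkit3
end KW

namespace KW

open Metric Set Pointwise

section step

variable {X : Type*} [MetricSpace X] {Γ : Type*} [Group Γ] [MulAction Γ X]

theorem IsometricAction.infDist (iso : IsometricAction Γ X) (g : Γ) (x : X) (O : Set X) :
    infDist (g • x) (g • O) = Metric.infDist x O := by
  have h : Isometry (fun y : X => g • y) := Isometry.of_dist_eq (iso g)
  exact Metric.infDist_image h

theorem IsometricAction.infDist_inv (iso : IsometricAction Γ X) (g : Γ) (x : X) (O : Set X) :
    Metric.infDist x (g • O) = Metric.infDist (g⁻¹ • x) O := by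
  rw [← iso.infDist g (g⁻¹ • x) O, smul_inv_smul]

theorem IsometricAction.dist_left (iso : IsometricAction Γ X) (g : Γ) (x y : X) :
    dist (g • x) y = dist x (g⁻¹ • y) := by
  rw [← iso g x (g⁻¹ • y), smul_inv_smul]

theorem IsometricAction.geod (iso : IsometricAction Γ X) (g : Γ) {γ : ℝ → X} {L : ℝ} {x y : X}
    (h : GeodParam γ L x y) : GeodParam (fun r => g • γ r) L (g • x) (g • y) := by
  refine ⟨h.1, by simp only [h.2.1], by simp only [h.2.2.1], fun u hu v hv => ?_⟩
  rw [iso]; exact h.2.2.2 u hu v hv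

theorem IsometricAction.dip (iso : IsometricAction Γ X) (g : Γ) {O : Set X} {μ T : ℝ}
    (h : Dip O μ T) : Dip (g • O) μ T := by
  intro γ L o o' ho ho' hγ τ1 τ2 a b c
  obtain ⟨τ, hτ, hd⟩ := h _ L _ _ (mem_smul_set_iff_inv_smul_mem.1 ho)
    (mem_smul_set_iff_inv_smul_mem.1 ho') (iso.geod g⁻¹ hγ) τ1 τ2 a b c
  exact ⟨τ, hτ, by rwa [iso.infDist_inv]⟩

structure StepCfg (K : Subgroup Γ) (O : Set X) (t : Γ) (l R' : ℝ) (z : X) : Prop where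
  iso : IsometricAction Γ X
  fp : FP X
  geo : Geo X
  On : O.Nonempty
  Kinv : ∀ g ∈ K, g • O = O
  H1 : ∀ x : X, l - 1 ≤ infDist x O + infDist (t⁻¹ • x) O
  z1 : infDist z O ≤ l / 2 + 1
  z2 : infDist (t⁻¹ • z) O ≤ l / 2 + 1
  H3 : ∀ v ∈ K, v ≠ 1 → R' ≤ dist z (v • z)
  H3' : ∀ v ∈ K, v ≠ 1 → R' ≤ dist (t⁻¹ • z) (v • t⁻¹ • z)
  H4 : ∀ g1 ∈ K, ∀ g2 ∈ K, ∀ x : X, R' ≤ dist x ((g1 * t * g2) • x)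

def oV (t : Γ) (e : Γ × Bool) : Γ := if e.2 then e.1 else e.1 * t
def tV (t : Γ) (e : Γ × Bool) : Γ := if e.2 then e.1 * t else e.1

def EAdj (K : Subgroup Γ) (t : Γ) (e e' : Γ × Bool) : Prop :=
  (tV t e)⁻¹ * oV t e' ∈ K ∧ ¬ (e'.1 = e.1 ∧ e'.2 = !e.2)

structure IsPath (K : Subgroup Γ) (t : Γ) (w : Γ) (n : ℕ) (e : ℕ → Γ × Bool) : Prop where
  zero : n = 0 → w ∈ K
  first : 0 < n → oV t (e 0) ∈ K
  last : 0 < n → (tV t (e (n - 1)))⁻¹ * w ∈ K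
  adj : ∀ i, i + 1 < n → EAdj K t (e i) (e (i + 1))

theorem IsPath.mulK {K : Subgroup Γ} {t w : Γ} {n : ℕ} {e : ℕ → Γ × Bool}
    (h : IsPath K t w n e) {k : Γ} (hk : k ∈ K) : IsPath K t (w * k) n e :=
  ⟨fun h0 => K.mul_mem (h.zero h0) hk, h.first,
    fun h0 => by rw [← mul_assoc]; exact K.mul_mem (h.last h0) hk, h.adj⟩

theorem IsPath.extend {K : Subgroup Γ} {t w : Γ} {n : ℕ} {e : ℕ → Γ × Bool}
    (h : IsPath K t w n e) (ε : Γ × Bool) (hε : oV t ε = w) :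
    ∃ n' e', IsPath K t (tV t ε) n' e' := by
  by_cases hc : 0 < n ∧ ε.1 = (e (n - 1)).1 ∧ ε.2 = !(e (n - 1)).2
  · obtain ⟨hn, h1, h2⟩ := hc
    have hv : tV t ε = oV t (e (n - 1)) := by
      simp only [tV, oV, h1, h2]
      cases (e (n - 1)).2 <;> simp
    refine ⟨n - 1, e, fun h0 => ?_, fun h0 => h.first hn, fun h0 => ?_, fun i hi => h.adj i (by omega)⟩
    · rw [hv, h0]; exact h.first hn
    · rw [hv]
      have := (h.adj (n - 1 - 1) (by omega)).1
      rwa [show n - 1 - 1 + 1 = n - 1 by omega] at this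
  · refine ⟨n + 1, fun i => if i < n then e i else ε, fun h0 => by omega, fun _ => ?_, fun _ => ?_,
      fun i hi => ?_⟩
    · by_cases h0 : 0 < n
      · simp only [h0, if_true]; exact h.first h0
      · simp only [h0, if_false, hε]; exact h.zero (by omega)
    · simp
    · by_cases h1 : i + 1 < n
      · simp only [h1, show i < n by omega, if_true]; exact h.adj i h1
      · obtain rfl : n = i + 1 := by omega
        simp only [lt_irrefl, if_false, Nat.lt_succ_self, if_true]
        refine ⟨?_, fun hh => hc ⟨by omega, ?_⟩⟩
        · rw [hε]; simpa using h.last (by omega)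
        · simpa using hh

theorem exists_path (K : Subgroup Γ) (t : Γ) {w : Γ}
    (hw : w ∈ Subgroup.closure ((K : Set Γ) ∪ {t})) : ∃ n e, IsPath K t w n e := by
  induction hw using Subgroup.closure_induction_right with
  | one => exact ⟨0, fun _ => (1, true), fun _ => K.one_mem, fun h => by omega, fun h => by omega,
      fun i hi => by omega⟩
  | mul_right x hx y hy ih =>
    obtain ⟨n, e, h⟩ := ih
    rcases hy with hy | hy
    · exact ⟨n, e, h.mulK hy⟩
    · rw [mem_singleton_iff] at hy
      subst hy
      simpa [tV] using h.extend (x, true) (by simp [oV])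
  | mul_inv_cancel x hx y hy ih =>
    obtain ⟨n, e, h⟩ := ih
    rcases hy with hy | hy
    · exact ⟨n, e, h.mulK (K.inv_mem hy)⟩
    · rw [mem_singleton_iff] at hy
      subst hy
      simpa [tV] using h.extend (x * y⁻¹, false) (by simp [oV])

variable {K : Subgroup Γ} {O : Set X} {t : Γ} {l R' : ℝ} {z : X}

theorem StepCfg.smulO (S : StepCfg K O t l R' z) {g h : Γ} (hk : g⁻¹ * h ∈ K) :
    h • O = g • O := by
  have := S.Kinv _ hk
  rw [mul_smul] at this
  conv_rhs => rw [← this]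
  rw [smul_inv_smul]

theorem StepCfg.edge_sum (S : StepCfg K O t l R' z) (e : Γ × Bool) (u : X) :
    l - 1 ≤ infDist u (oV t e • O) + infDist u (tV t e • O) := by
  have := S.H1 (e.1⁻¹ • u)
  rw [S.iso.infDist_inv, S.iso.infDist_inv]
  rcases e with ⟨g, b⟩
  cases b <;> simp only [oV, tV, mul_inv_rev, mul_smul, if_true, Bool.false_eq_true, if_false] at * <;> linarith

theorem StepCfg.edge_o (S : StepCfg K O t l R' z) (e : Γ × Bool) :
    infDist (e.1 • z) (oV t e • O) ≤ l / 2 + 1 := by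
  rw [S.iso.infDist_inv]
  rcases e with ⟨g, b⟩
  have h1 := S.z1
  have h2 := S.z2
  cases b <;> simpa [oV, mul_smul]

theorem StepCfg.edge_t (S : StepCfg K O t l R' z) (e : Γ × Bool) :
    infDist (e.1 • z) (tV t e • O) ≤ l / 2 + 1 := by
  rw [S.iso.infDist_inv]
  rcases e with ⟨g, b⟩
  have h1 := S.z1
  have h2 := S.z2
  cases b <;> simpa [tV, mul_smul]

theorem StepCfg.edge_adj (S : StepCfg K O t l R' z) {e e' : Γ × Bool} (h : EAdj K t e e') :
    R' ≤ dist (e.1 • z) (e'.1 • z) := by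
  rcases e with ⟨g, b⟩
  rcases e' with ⟨g', b'⟩
  obtain ⟨h1, h2⟩ := h
  rw [S.iso.dist_left, ← mul_smul]
  cases b <;> cases b' <;> simp [oV, tV] at h1 h2 ⊢
  · have := S.H4 _ (K.inv_mem h1) 1 K.one_mem (t⁻¹ • z)
    rw [dist_comm, S.iso.dist_left] at this
    simp [mul_smul] at this
    rw [S.iso] at this
    simpa [mul_smul] using this
  · exact S.H3 _ h1 fun h => h2 (by rw [inv_mul_eq_one] at h; exact h.symm)
  · have := S.H3' _ h1 fun h => h2 (by
      rw [mul_assoc, inv_mul_eq_one] at h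
      have : g⁻¹ * g' = 1 := by
        rw [← mul_assoc] at h
        exact (mul_right_cancel (b := t) (by rw [one_mul]; exact h.symm))
      rw [inv_mul_eq_one] at this; exact this.symm)
    rw [S.iso.dist_left] at this
    simpa [mul_smul] using this
  · have := S.H4 1 K.one_mem _ h1 z
    simpa [mul_smul] using this

end step
end KW

namespace KW

open Metric Set Pointwise

section step2

variable {X : Type*} [MetricSpace X] {Γ : Type*} [Group Γ] [MulAction Γ X]
variable {K : Subgroup Γ} {O : Set X} {t : Γ} {l R' : ℝ} {z : X}

theorem IsPath.mem {w : Γ} {n : ℕ} {e : ℕ → Γ × Bool} (h : IsPath K t w n e) (i : ℕ) (hi : i < n) :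
    oV t (e i) ∈ Subgroup.closure ((K : Set Γ) ∪ {t}) ∧
    tV t (e i) ∈ Subgroup.closure ((K : Set Γ) ∪ {t}) := by
  have hK : ∀ k ∈ K, k ∈ Subgroup.closure ((K : Set Γ) ∪ {t}) := fun k hk =>
    Subgroup.subset_closure (Or.inl hk)
  have ht : t ∈ Subgroup.closure ((K : Set Γ) ∪ {t}) := Subgroup.subset_closure (Or.inr rfl)
  have aux : ∀ ε : Γ × Bool, oV t ε ∈ Subgroup.closure ((K : Set Γ) ∪ {t}) →
      tV t ε ∈ Subgroup.closure ((K : Set Γ) ∪ {t}) := by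
    rintro ⟨g, b⟩ hg
    cases b
    · simp only [oV, tV, Bool.false_eq_true, if_false] at hg ⊢
      simpa using Subgroup.mul_mem _ hg (Subgroup.inv_mem _ ht)
    · simp only [oV, tV, if_true] at hg ⊢
      exact Subgroup.mul_mem _ hg ht
  have key : oV t (e i) ∈ Subgroup.closure ((K : Set Γ) ∪ {t}) := by
    induction i with
    | zero => exact hK _ (h.first hi)
    | succ i ih =>
      have h1 := aux _ (ih (by omega))
      have := Subgroup.mul_mem _ h1 (hK _ (h.adj i hi).1)
      simpa using this
  exact ⟨key, aux _ key⟩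

/-- the chain of edge midpoints attached to a path -/
def pathPt (z o o' : X) (n : ℕ) (e : ℕ → Γ × Bool) : ℕ → X
  | 0 => o
  | (i + 1) => if i < n then (e i).1 • z else o'

def pathSet (t : Γ) (O : Set X) (e : ℕ → Γ × Bool) : ℕ → Set X
  | 0 => O
  | (i + 1) => tV t (e i) • O

theorem StepCfg.pathSet_o (S : StepCfg K O t l R' z) {w : Γ} {n : ℕ} {e : ℕ → Γ × Bool}
    (h : IsPath K t w n e) (i : ℕ) (hi : i < n) : pathSet t O e i = oV t (e i) • O := by
  cases i with
  | zero => exact (S.Kinv _ (h.first hi)).symm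
  | succ i => exact (S.smulO (h.adj i hi).1).symm

theorem StepCfg.pathSet_last (S : StepCfg K O t l R' z) {w : Γ} {n : ℕ} {e : ℕ → Γ × Bool}
    (h : IsPath K t w n e) : pathSet t O e n = w • O := by
  cases n with
  | zero => exact (S.Kinv _ (h.zero rfl)).symm
  | succ n => exact (S.smulO (h.last (by omega))).symm

theorem pathSet_eq (t : Γ) (O : Set X) {w : Γ} {n : ℕ} {e : ℕ → Γ × Bool} (h : IsPath K t w n e)
    (i : ℕ) (hi : i ≤ n) :
    ∃ g ∈ Subgroup.closure ((K : Set Γ) ∪ {t}), pathSet t O e i = g • O := by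
  cases i with
  | zero => exact ⟨1, Subgroup.one_mem _, (one_smul _ _).symm⟩
  | succ i => exact ⟨_, (h.mem i (by omega)).2, rfl⟩

theorem StepCfg.pathPt_left (S : StepCfg K O t l R' z) (hl : 0 ≤ l) {w : Γ} {n : ℕ}
    {e : ℕ → Γ × Bool} {o o' : X} (ho : o ∈ O) (i : ℕ) (hi : i ≤ n) :
    infDist (pathPt z o o' n e i) (pathSet t O e i) ≤ l / 2 + 1 := by
  cases i with
  | zero => simp only [pathPt, pathSet]; rw [infDist_zero_of_mem ho]; linarith
  | succ i => simp only [pathPt, pathSet, if_pos (show i < n by omega)]; exact S.edge_t _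

theorem StepCfg.pathPt_right (S : StepCfg K O t l R' z) (hl : 0 ≤ l) {w : Γ} {n : ℕ}
    {e : ℕ → Γ × Bool} (h : IsPath K t w n e) {o o' : X} (ho' : o' ∈ w • O) (i : ℕ) (hi : i ≤ n) :
    infDist (pathPt z o o' n e (i + 1)) (pathSet t O e i) ≤ l / 2 + 1 := by
  rcases Nat.lt_or_ge i n with hi' | hi'
  · simp only [pathPt, if_pos hi']
    rw [S.pathSet_o h i hi']; exact S.edge_o _
  · obtain rfl : i = n := le_antisymm hi hi'
    rw [S.pathSet_last h]
    simp only [pathPt, lt_irrefl, if_false]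
    rw [infDist_zero_of_mem ho']; linarith

theorem StepCfg.first_dist (S : StepCfg K O t l R' z) {w : Γ} {n : ℕ}
    {e : ℕ → Γ × Bool} (h : IsPath K t w n e) {o o' : X} (ho : o ∈ O) (hn : 0 < n) :
    l / 2 - 2 ≤ dist (pathPt z o o' n e 0) (pathPt z o o' n e 1) := by
  simp only [pathPt, if_pos hn]
  have h1 := S.edge_sum (e 0) ((e 0).1 • z)
  have h2 := S.edge_t (e 0)
  rw [S.Kinv _ (h.first hn)] at h1
  have := infDist_le_dist_of_mem (x := (e 0).1 • z) ho
  rw [dist_comm]; linarith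

theorem StepCfg.last_dist (S : StepCfg K O t l R' z) {w : Γ} {n : ℕ}
    {e : ℕ → Γ × Bool} (h : IsPath K t w n e) {o o' : X} (ho' : o' ∈ w • O) (hn : 0 < n) :
    l / 2 - 2 ≤ dist (pathPt z o o' n e n) (pathPt z o o' n e (n + 1)) := by
  obtain ⟨k, rfl⟩ : ∃ k, n = k + 1 := ⟨n - 1, by omega⟩
  simp only [pathPt, Nat.lt_succ_self, if_true, lt_irrefl, if_false]
  have h1 := S.edge_sum (e k) ((e k).1 • z)
  have h2 := S.edge_o (e k)
  have h3 := S.smulO (h.last hn)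
  simp only [Nat.add_sub_cancel] at h3
  rw [← h3] at h1
  have := infDist_le_dist_of_mem (x := (e k).1 • z) ho'
  linarith

theorem StepCfg.chain (S : StepCfg K O t l R' z) (hl : 0 ≤ l) {T T0 : ℝ} (hT : 0 ≤ T)
    (hT0 : 0 ≤ T0) (hdP : Dip O (l / 2 - (T0 + 40)) T) (hdQ : Dip O (l / 2) T0)
    (hR : 2 * (T0 + T + 66) ≤ R') (hRl : R' ≤ l / 2 - 2) {w : Γ} {n : ℕ}
    {e : ℕ → Γ × Bool} (h : IsPath K t w n e) (hn : 0 < n) {o o' : X} (ho : o ∈ O)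
    (ho' : o' ∈ w • O) :
    Chain (pathPt z o o' n e) (n + 1) (T0 + T + 66) R' := by
  have hd : ∀ i, i + 1 ≤ n + 1 →
      R' ≤ dist (pathPt z o o' n e i) (pathPt z o o' n e (i + 1)) := by
    intro i hi
    rcases Nat.eq_zero_or_pos i with rfl | hi0
    · exact hRl.trans (S.first_dist h ho hn)
    rcases Nat.lt_or_ge i n with hin | hin
    · obtain ⟨k, rfl⟩ : ∃ k, i = k + 1 := ⟨i - 1, by omega⟩
      simp only [pathPt, if_pos hin, if_pos (show k < n by omega)]
      exact S.edge_adj (h.adj k hin)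
    · obtain rfl : i = n := by omega
      exact hRl.trans (S.last_dist h ho' hn)
  refine ⟨hd, fun i hi => ?_⟩
  have hin : i < n := by omega
  obtain ⟨g, hg, hge⟩ := pathSet_eq t O h i hin.le
  have hP : (pathSet t O e i).Nonempty := by rw [hge]; exact S.On.smul_set
  have hx := S.pathPt_left (w := w) (e := e) (o' := o') hl ho i hin.le
  have hy := S.pathPt_right (o := o) hl h ho' (i + 1) hin
  have hM : pathPt z o o' n e (i + 1) = (e i).1 • z := by simp only [pathPt, if_pos hin]
  have d1 := hd i (by omega)
  have d2 := hd (i + 1) (by omega)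
  refine lemA S.fp S.geo hP (Q := tV t (e i) • O) S.On.smul_set hl hT hT0
    (by rw [hge]; exact S.iso.dip g hdP) (S.iso.dip _ hdQ) (fun u => ?_) ?_ ?_ hx hy hR d1 d2
  · rw [S.pathSet_o h i hin]; exact S.edge_sum _ _
  · rw [hM, S.pathSet_o h i hin]; exact S.edge_o _
  · rw [hM]; exact S.edge_t _

/-- length-one words -/
theorem StepCfg.one_word (S : StepCfg K O t l R' z) {w : Γ} {e : ℕ → Γ × Bool} {R : ℝ}
    (hR : ∀ g1 ∈ K, ∀ g2 ∈ K, ∀ x : X, R ≤ dist x ((g1 * t * g2) • x))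
    (h : IsPath K t w 1 e) (x : X) : R ≤ dist x (w • x) := by
  have h1 := h.first (by omega)
  have h2 := h.last (by omega)
  simp only [Nat.sub_self] at h2
  rcases he : e 0 with ⟨g, b⟩
  rw [he] at h1 h2
  cases b
  · simp only [oV, tV, Bool.false_eq_true, if_false] at h1 h2
    have := hR _ (K.inv_mem h2) _ (K.inv_mem h1) x
    rw [dist_comm, S.iso.dist_left] at this
    convert this using 3
    group
  · simp only [oV, tV, if_true] at h1 h2
    have := hR _ h1 _ h2 x
    convert this using 3
    group

theorem StepCfg.long_word (S : StepCfg K O t l R' z) {C : ℝ} (hC : 0 ≤ C) (hR : 2 * C + 7 ≤ R')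
    {w : Γ} {n : ℕ} {e : ℕ → Γ × Bool} (h : IsPath K t w n e) (hn : 2 ≤ n) {o o' : X} (ho : o ∈ O)
    (ho' : o' ∈ w • O) (hch : Chain (pathPt z o o' n e) (n + 1) C R') :
    l + R' - 4 * C - 20 ≤ dist o o' := by
  have m1 := hch.mid S.fp hC hR (j := 1) (by omega)
  have m2 := (hch.shift 1).mid S.fp hC hR (j := n - 1) (by omega)
  simp only [show 1 + (n - 1) = n by omega, show 1 + (n + 1 - 1) = n + 1 by omega] at m2
  have p := hch.pair S.fp hC hR (i := 1) (j := n) (by omega) (by omega)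
  have f := S.first_dist h (o' := o') ho (by omega)
  have g := S.last_dist h (o := o) ho' (by omega)
  have e0 : pathPt z o o' n e 0 = o := rfl
  have e1 : pathPt z o o' n e (n + 1) = o' := by simp [pathPt]
  rw [e0, e1] at m1
  rw [e0] at f
  rw [e1] at g m2
  simp only [Nat.add_zero] at m2
  linarith

/-- Dip for the bigger orbit set -/
theorem StepCfg.dip_step (S : StepCfg K O t l R' z) (hl : 0 ≤ l) {T T0 Th c : ℝ} (hT : 0 ≤ T)
    (hT0 : 0 ≤ T0) (hTh : 0 ≤ Th) (hc : 0 ≤ c)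
    (hdP : Dip O (l / 2 - (T0 + 40)) T) (hdQ : Dip O (l / 2) T0)
    (hdh : Dip O (l / 2 - cHat c (T0 + T + 66)) Th)
    (hR : 2 * (T0 + T + 66) + 7 ≤ R') (hRl : R' ≤ l / 2 - 2)
    (hR2 : 3 * cB c (T0 + T + 66) Th + 2 * (T0 + T + 66 + 8) < R') {O' : Set X}
    (hO1 : ∀ g ∈ Subgroup.closure ((K : Set Γ) ∪ {t}), g • O ⊆ O')
    (hO2 : ∀ x ∈ O', ∃ g ∈ Subgroup.closure ((K : Set Γ) ∪ {t}), x ∈ g • O)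
    (hO3 : ∀ g ∈ Subgroup.closure ((K : Set Γ) ∪ {t}), g • O' = O') :
    Dip O' (l / 2 - c) (4 * cB c (T0 + T + 66) Th) := by
  intro γ L o1 o2 ho1 ho2 hγ τ1 τ2 h1 h12 h2
  obtain ⟨g1, hg1, hm1⟩ := hO2 _ ho1
  obtain ⟨g2, hg2, hm2⟩ := hO2 _ ho2
  have hw : g1⁻¹ * g2 ∈ Subgroup.closure ((K : Set Γ) ∪ {t}) :=
    Subgroup.mul_mem _ (Subgroup.inv_mem _ hg1) hg2
  have hγ' := S.iso.geod g1⁻¹ hγ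
  have ha : g1⁻¹ • o1 ∈ O := mem_smul_set_iff_inv_smul_mem.1 hm1
  have hb : g1⁻¹ • o2 ∈ (g1⁻¹ * g2) • O := by
    rw [mul_smul]; exact smul_mem_smul_set hm2
  have key : ∃ τ ∈ Icc τ1 τ2, infDist (g1⁻¹ • γ τ) O' ≤ l / 2 - c := by
    obtain ⟨n, e, hp⟩ := exists_path K t hw
    rcases Nat.eq_zero_or_pos n with hn | hn
    · rw [S.Kinv _ (hp.zero hn)] at hb
      have hch : cHat c (T0 + T + 66) = c + 4 * (T0 + T + 66 + 8) + 20 := rfl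
      have hcb : cB c (T0 + T + 66) Th = 2 * (cHat c (T0 + T + 66) + 5 * (T0 + T + 66 + 8) + 10)
        + Th + 4 * (T0 + T + 66 + 8) + 16 := rfl
      obtain ⟨τ, hτ, hd⟩ := hdh _ L _ _ ha hb hγ' τ1 τ2 h1 (by linarith) h2
      refine ⟨τ, hτ, ?_⟩
      have hsub : O ⊆ O' := by
        have := hO1 1 (Subgroup.one_mem _); rwa [one_smul] at this
      have := infDist_le_infDist_of_subset (x := g1⁻¹ • γ τ) hsub S.On
      linarith
    · have hch := S.chain hl hT hT0 hdP hdQ (by linarith) hRl hp hn ha hb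
      have e1 : pathPt z (g1⁻¹ • o1) (g1⁻¹ • o2) n e (n + 1) = g1⁻¹ • o2 := by simp [pathPt]
      have hγ2 : GeodParam (fun r => g1⁻¹ • γ r) L (pathPt z (g1⁻¹ • o1) (g1⁻¹ • o2) n e 0)
          (pathPt z (g1⁻¹ • o1) (g1⁻¹ • o2) n e (n + 1)) := by rw [e1]; exact hγ'
      refine lemU2 S.fp S.geo (by linarith) hR hch (P := pathSet t O e) (O' := O')
        hc hTh (fun i hi => ?_) (fun i hi => ?_) (fun i hi => ?_) (fun i hi => ?_)
        (fun i hi => ?_) hR2 hγ2 h1 h12 h2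
      · obtain ⟨g, hg, hge⟩ := pathSet_eq t O hp i (by omega)
        rw [hge]; exact S.On.smul_set
      · obtain ⟨g, hg, hge⟩ := pathSet_eq t O hp i (by omega)
        rw [hge]; exact hO1 g hg
      · exact S.pathPt_left (w := g1⁻¹ * g2) hl ha i (by omega)
      · exact S.pathPt_right hl hp hb i (by omega)
      · obtain ⟨g, hg, hge⟩ := pathSet_eq t O hp i (by omega)
        rw [hge]; exact S.iso.dip g hdh
  obtain ⟨τ, hτ, hd⟩ := key
  refine ⟨τ, hτ, ?_⟩
  rwa [← S.iso.infDist_inv, hO3 _ hg1] at hd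

end step2
end KW

namespace KW

open Metric Set Pointwise

section cfg

structure Cfg {Γ : Type u} {X : Type v} [MetricSpace X] [Group Γ] [MulAction Γ X] {m : ℕ}
    (V : Subgroup Γ) (A : Set X) (t : Fin m → Γ) (l : Fin m → ℝ) (R : ℝ) : Prop where
  iso : IsometricAction Γ X
  fp : FP X
  geo : Geo X
  An : A.Nonempty
  Ainv : ∀ v ∈ V, v • A = A
  qc : ∀ (γ : ℝ → X) (L : ℝ) (a b : X), a ∈ A → b ∈ A → GeodParam γ L a b →
    ∀ τ ∈ Icc 0 L, infDist (γ τ) A ≤ 20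
  sd : ∀ v ∈ V, v ≠ 1 → ∀ x : X, dist x (v • x) ≤ 100 → x ∈ A
  lR : ∀ k, R ≤ l k
  ex : ∀ k, ∃ a ∈ A, ∃ b ∈ A, dist a (t k • b) ≤ l k + 1
  low : ∀ k, ∀ g1 ∈ Subgroup.closure ((V : Set Γ) ∪ t '' {j | j ≠ k}),
    ∀ g2 ∈ Subgroup.closure ((V : Set Γ) ∪ t '' {j | j ≠ k}), ∀ a ∈ A, ∀ b ∈ A,
    l k - 1 ≤ dist a ((g1 * t k * g2) • b)
  disp : ∀ k, ∀ g1 ∈ Subgroup.closure ((V : Set Γ) ∪ t '' {j | j ≠ k}),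
    ∀ g2 ∈ Subgroup.closure ((V : Set Γ) ∪ t '' {j | j ≠ k}), ∀ x : X,
    R ≤ dist x ((g1 * t k * g2) • x)

variable {X : Type v} [MetricSpace X] {Γ : Type u} [Group Γ] [MulAction Γ X] {m : ℕ}

def KS (V : Subgroup Γ) (t : Fin m → Γ) (S : Finset (Fin m)) : Subgroup Γ :=
  Subgroup.closure ((V : Set Γ) ∪ t '' (S : Set (Fin m)))

def OS (V : Subgroup Γ) (A : Set X) (t : Fin m → Γ) (S : Finset (Fin m)) : Set X :=
  {x | ∃ g ∈ KS V t S, x ∈ g • A}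

theorem KS_empty (V : Subgroup Γ) (t : Fin m → Γ) : KS V t ∅ = V := by
  simp [KS]

theorem KS_insert (V : Subgroup Γ) (t : Fin m → Γ) (S : Finset (Fin m)) (k : Fin m) :
    KS V t (insert k S) = Subgroup.closure ((KS V t S : Set Γ) ∪ {t k}) := by
  apply le_antisymm
  · refine (Subgroup.closure_le _).2 ?_
    rintro x (hx | ⟨j, hj, rfl⟩)
    · exact Subgroup.subset_closure (Or.inl (Subgroup.subset_closure (Or.inl hx)))
    · rw [Finset.mem_coe, Finset.mem_insert] at hj
      rcases hj with rfl | hj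
      · exact Subgroup.subset_closure (Or.inr rfl)
      · exact Subgroup.subset_closure (Or.inl (Subgroup.subset_closure (Or.inr ⟨j, hj, rfl⟩)))
  · refine (Subgroup.closure_le _).2 ?_
    rintro x (hx | hx)
    · refine Subgroup.closure_mono ?_ hx
      refine union_subset_union_right _ (image_mono ?_)
      simp
    · rw [mem_singleton_iff] at hx
      subst hx
      exact Subgroup.subset_closure (Or.inr ⟨k, by simp, rfl⟩)

theorem KS_le (V : Subgroup Γ) (t : Fin m → Γ) {S : Finset (Fin m)} {k : Fin m} (hk : k ∉ S) :
    KS V t S ≤ Subgroup.closure ((V : Set Γ) ∪ t '' {j | j ≠ k}) := by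
  refine Subgroup.closure_mono (union_subset_union_right _ (image_mono ?_))
  rintro j hj rfl
  exact hk hj

theorem OS_inv (V : Subgroup Γ) (A : Set X) (t : Fin m → Γ) (S : Finset (Fin m)) {g : Γ}
    (hg : g ∈ KS V t S) : g • OS V A t S = OS V A t S := by
  have aux : ∀ g ∈ KS V t S, g • OS V A t S ⊆ OS V A t S := by
    rintro g hg _ ⟨x, ⟨h, hh, hx⟩, rfl⟩
    refine ⟨g * h, Subgroup.mul_mem _ hg hh, ?_⟩
    rw [mul_smul]; exact smul_mem_smul_set hx
  refine subset_antisymm (aux g hg) ?_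
  have := aux _ (Subgroup.inv_mem _ hg)
  rwa [← subset_smul_set_iff.trans (Iff.rfl)] at this

theorem subset_OS (V : Subgroup Γ) (A : Set X) (t : Fin m → Γ) (S : Finset (Fin m)) :
    A ⊆ OS V A t S := fun x hx => ⟨1, Subgroup.one_mem _, by rwa [one_smul]⟩

variable {V : Subgroup Γ} {A : Set X} {t : Fin m → Γ} {l : Fin m → ℝ} {R : ℝ}

theorem Cfg.OS_empty (h : Cfg V A t l R) : OS V A t ∅ = A := by
  refine subset_antisymm ?_ (subset_OS V A t ∅)
  rintro x ⟨g, hg, hx⟩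
  rw [KS_empty] at hg
  rwa [h.Ainv g hg] at hx

theorem Cfg.OS_ne (h : Cfg V A t l R) (S : Finset (Fin m)) : (OS V A t S).Nonempty :=
  h.An.mono (subset_OS V A t S)

theorem Cfg.H1 (h : Cfg V A t l R) {S : Finset (Fin m)} {k : Fin m} (hk : k ∉ S) (x : X) :
    l k - 1 ≤ infDist x (OS V A t S) + infDist ((t k)⁻¹ • x) (OS V A t S) := by
  refine le_of_forall_pos_le_add fun ε hε => ?_
  obtain ⟨o, ⟨g1, hg1, ho⟩, hd⟩ := exists_close (h.OS_ne S)
    (show infDist x (OS V A t S) < infDist x (OS V A t S) + ε / 2 by linarith)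
  obtain ⟨o', ⟨g2, hg2, ho'⟩, hd'⟩ := exists_close (h.OS_ne S)
    (show infDist ((t k)⁻¹ • x) (OS V A t S) < infDist ((t k)⁻¹ • x) (OS V A t S) + ε / 2
      by linarith)
  obtain ⟨a, ha, rfl⟩ := ho
  obtain ⟨b, hb, rfl⟩ := ho'
  have hle := KS_le V t hk
  have key := h.low k _ (Subgroup.inv_mem _ (hle hg1)) _ (hle hg2) a ha b hb
  have e : dist a ((g1⁻¹ * t k * g2) • b) = dist (g1 • a) (t k • g2 • b) := by
    rw [h.iso.dist_left]; simp only [mul_smul]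
  rw [← h.iso (t k), smul_inv_smul] at hd'
  have tr := dist_triangle (g1 • a) x (t k • g2 • b)
  have c := dist_comm x (g1 • a)
  simp only at hd hd'
  linarith

end cfg

/-- the inductive statements -/
def IH2 (m n : ℕ) : Prop := ∀ c : ℝ, 0 ≤ c → ∃ T : ℝ, 0 ≤ T ∧ ∃ R1 : ℝ,
  ∀ (Γ : Type u) (X : Type v) [MetricSpace X] [Group Γ] [MulAction Γ X]
    (V : Subgroup Γ) (A : Set X) (t : Fin m → Γ) (l : Fin m → ℝ) (R : ℝ),
    Cfg V A t l R → R1 ≤ R → ∀ S : Finset (Fin m), S.card = n → ∀ lam : ℝ, R ≤ lam →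
    (∀ j ∈ S, l j ≤ lam) → Dip (OS V A t S) (lam / 2 - c) T

def IH3 (m n : ℕ) : Prop := ∀ T : ℝ, 0 ≤ T → ∃ D : ℝ, ∃ R1 : ℝ,
  ∀ (Γ : Type u) (X : Type v) [MetricSpace X] [Group Γ] [MulAction Γ X]
    (V : Subgroup Γ) (A : Set X) (t : Fin m → Γ) (l : Fin m → ℝ) (R : ℝ),
    Cfg V A t l R → R1 ≤ R → ∀ S : Finset (Fin m), S.card = n → ∀ w ∈ KS V t S, w ≠ 1 →
    ∀ x : X, dist x (w • x) ≤ T → infDist x (OS V A t S) ≤ D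

def IH5 (m n : ℕ) : Prop := ∃ R1 : ℝ,
  ∀ (Γ : Type u) (X : Type v) [MetricSpace X] [Group Γ] [MulAction Γ X]
    (V : Subgroup Γ) (A : Set X) (t : Fin m → Γ) (l : Fin m → ℝ) (R : ℝ),
    Cfg V A t l R → R1 ≤ R → ∀ S : Finset (Fin m), S.card = n → ∀ w ∈ KS V t S,
    (∀ x : X, w • x = x) → w = 1

theorem midPt {X : Type*} [MetricSpace X] (hfp : FP X) {γ : ℝ → X} {a a' x : X} {T : ℝ}
    (hγ : GeodParam γ (dist a a') a a') (hT : 0 ≤ T) (hx : dist a' x ≤ dist a x + T) :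
    dist a a' / 2 ∈ Icc 0 (dist a a') ∧
    dist x (γ (dist a a' / 2)) ≤ dist a x + T + 4 - dist a a' / 2 := by
  have hm : dist a a' / 2 ∈ Icc 0 (dist a a') := ⟨by linarith [hγ.1], by linarith [hγ.1]⟩
  refine ⟨hm, ?_⟩
  have l1 := hγ.left hm
  have r1 := hγ.right hm
  have c := dist_comm (γ (dist a a' / 2)) a'
  rcases hfp.or a a' x (γ (dist a a' / 2)) with h | h
  · linarith
  · linarith

theorem IH2_zero (m : ℕ) : IH2.{u, v} m 0 := by
  intro c hc
  refine ⟨0, le_rfl, 40 + 2 * c, ?_⟩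
  intro Γ X _ _ _ V A t l R h hR S hS lam hlam _
  obtain rfl := Finset.card_eq_zero.1 hS
  rw [h.OS_empty]
  intro γ L o o' ho ho' hγ τ1 τ2 h1 h12 h2
  refine ⟨τ1, ⟨le_rfl, by linarith⟩, (h.qc γ L o o' ho ho' hγ τ1 ⟨h1, by linarith⟩).trans ?_⟩
  linarith

theorem IH5_zero (m : ℕ) (hm : 1 ≤ m) : IH5.{u, v} m 0 := by
  refine ⟨2, ?_⟩
  intro Γ X _ _ _ V A t l R h hR S hS w hw hx
  obtain rfl := Finset.card_eq_zero.1 hS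
  rw [KS_empty] at hw
  by_contra hne
  have hA : ∀ x : X, x ∈ A := fun x => h.sd w hw hne x (by rw [hx, dist_self]; norm_num)
  obtain ⟨b, hb⟩ := h.An
  have := h.low ⟨0, hm⟩ 1 (Subgroup.one_mem _) 1 (Subgroup.one_mem _) _ (hA (t ⟨0, hm⟩ • b)) b hb
  have h2 := h.lR ⟨0, hm⟩
  rw [one_mul, mul_one, dist_self] at this
  linarith

theorem IH3_zero (m : ℕ) : IH3.{u, v} m 0 := by
  intro T hT
  refine ⟨58 + 3 * T, 0, ?_⟩
  intro Γ X _ _ _ V A t l R h hR S hS v hv hne x hx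
  obtain rfl := Finset.card_eq_zero.1 hS
  rw [KS_empty] at hv
  rw [h.OS_empty]
  obtain ⟨a, ha, hax⟩ := exists_close h.An (show infDist x A < infDist x A + 1 by linarith)
  have hva : v • a ∈ A := by rw [← h.Ainv v hv]; exact smul_mem_smul_set ha
  have hfx := infDist_le_dist_of_mem (x := x) ha
  have cax := dist_comm x a
  by_contra hcon
  push Not at hcon
  -- bound on `d(a, va)`
  obtain ⟨β, hβ⟩ := h.geo a (v • a)
  have hivx : dist (v • a) (v • x) = dist a x := h.iso v a x
  have t1 := dist_triangle (v • a) (v • x) x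
  have c1 := dist_comm (v • x) x
  obtain ⟨hm, hmd⟩ := midPt h.fp hβ hT (x := x) (by linarith)
  have q := h.qc β _ _ _ ha hva hβ _ hm
  have iu := infDist_le_add (O := A) (x := x) (y := β (dist a (v • a) / 2))
  have hE : dist a (v • a) ≤ 50 + 2 * T := by linarith
  set E := dist a (v • a) with hEdef
  -- point on `[a,x]`
  obtain ⟨α, hα⟩ := h.geo a x
  set s := 53 + 2 * T with hs
  have ms : s ∈ Icc 0 (dist a x) := ⟨by linarith, by linarith⟩
  have ls := hα.left ms
  have rs := hα.right ms
  have n1 : dist (α s) (v • a) + (dist a x - s) ≤ dist x (v • a) + 4 := by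
    rcases h.fp.or a x (α s) (v • a) with h' | h'
    · have := dist_comm (α s) a; linarith
    · have t2 := dist_triangle a (v • a) (α s)
      have c2 := dist_comm (v • a) (α s)
      have c3 := dist_comm x (α s)
      linarith
  have n2 : dist (α s) (v • x) + dist (α s) (v • a) ≤ dist a x + 8 := by
    have c3 := dist_comm x (α s)
    have c4 := dist_comm (v • a) x
    have c5 := dist_comm (v • a) (α s)
    rcases h.fp.or (v • a) x (α s) (v • x) with h' | h'
    · have t2 := dist_triangle x (v • x) (α s)
      have c2 := dist_comm (v • x) (α s)
      linarith
    · linarith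
  obtain ⟨r, hr, hrd⟩ := near h.fp (h.iso.geod v hα) (α s)
  have f1 := infDist_le_add (O := A) (x := x) (y := α s)
  have f2 := infDist_le_dist_of_mem (x := α s) ha
  have f3 : infDist (v • α r) A = infDist (α r) A := by
    conv_lhs => rw [← h.Ainv v hv]
    exact h.iso.infDist v _ _
  have lr := hα.left hr
  have rr := hα.right hr
  have f4 := infDist_le_add (O := A) (x := x) (y := α r)
  have f5 := infDist_le_dist_of_mem (x := α r) ha
  have f6 := infDist_le_add (O := A) (x := α s) (y := v • α r)
  have f7 := infDist_le_add (O := A) (x := v • α r) (y := α s)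
  have c6 := dist_comm (α s) (v • α r)
  have c7 := dist_comm (α s) a
  have c8 := dist_comm (α r) a
  have c9 := dist_comm (α s) x
  have c10 := dist_comm (α r) x
  have hd : dist (α s) (v • α s) ≤ 100 := by
    have t3 := dist_triangle (α s) (v • α r) (v • α s)
    rw [h.iso v (α r) (α s), hα.2.2.2 r hr s ms] at t3
    have : |r - s| ≤ 20 := abs_le.2 ⟨by linarith, by linarith⟩
    linarith
  have hmem := h.sd v hv hne _ hd
  rw [infDist_zero_of_mem hmem] at f1
  linarith

theorem stepCfg_exists {m n : ℕ} (ih3 : IH3.{u, v} m n) (R' : ℝ) (hR' : 0 ≤ R') : ∃ R1 : ℝ,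
    ∀ (Γ : Type u) (X : Type v) [MetricSpace X] [Group Γ] [MulAction Γ X]
    (V : Subgroup Γ) (A : Set X) (t : Fin m → Γ) (l : Fin m → ℝ) (R : ℝ),
    Cfg V A t l R → R1 ≤ R → ∀ S : Finset (Fin m), S.card = n → ∀ k ∉ S,
    ∃ z, StepCfg (KS V t S) (OS V A t S) (t k) (l k) R' z := by
  obtain ⟨D, R1, hD⟩ := ih3 R' hR'
  refine ⟨max R1 (max R' (2 * D + 6)), ?_⟩
  intro Γ X _ _ _ V A t l R h hR S hS k hk
  have hRa : R1 ≤ R := (le_max_left _ _).trans hR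
  have hRb : R' ≤ R := ((le_max_left _ _).trans (le_max_right _ _)).trans hR
  have hRc : 2 * D + 6 ≤ R := ((le_max_right _ _).trans (le_max_right _ _)).trans hR
  have hlk := h.lR k
  obtain ⟨a, ha, b, hb, hab⟩ := h.ex k
  obtain ⟨γ, hγ⟩ := h.geo a (t k • b)
  have hm : dist a (t k • b) / 2 ∈ Icc 0 (dist a (t k • b)) :=
    ⟨by linarith [hγ.1], by linarith [hγ.1]⟩
  set z := γ (dist a (t k • b) / 2) with hz
  have l1 := hγ.left hm
  have r1 := hγ.right hm
  have z1 : infDist z (OS V A t S) ≤ l k / 2 + 1 := by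
    have := infDist_le_dist_of_mem (x := z) (subset_OS V A t S ha)
    rw [dist_comm] at this
    linarith
  have z2 : infDist ((t k)⁻¹ • z) (OS V A t S) ≤ l k / 2 + 1 := by
    have := infDist_le_dist_of_mem (x := (t k)⁻¹ • z) (subset_OS V A t S hb)
    rw [h.iso.dist_left, inv_inv] at this
    linarith
  have hH := h.H1 hk z
  refine ⟨z, h.iso, h.fp, h.geo, h.OS_ne S, fun g hg => OS_inv V A t S hg, h.H1 hk, z1, z2, ?_, ?_,
    ?_⟩
  · intro v hv hne
    by_contra hc
    have := hD Γ X V A t l R h hRa S hS v hv hne z (not_le.1 hc).le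
    linarith
  · intro v hv hne
    by_contra hc
    have := hD Γ X V A t l R h hRa S hS v hv hne _ (not_le.1 hc).le
    linarith
  · intro g1 hg1 g2 hg2 x
    exact hRb.trans (h.disp k g1 (KS_le V t hk hg1) g2 (KS_le V t hk hg2) x)

end KW

namespace KW

open Metric Set Pointwise

theorem chooseK {m n : ℕ} (l : Fin m → ℝ) {S : Finset (Fin m)} (hS : S.card = n + 1) :
    ∃ k S0, k ∉ S0 ∧ S = insert k S0 ∧ S0.card = n ∧ ∀ j ∈ S, l j ≤ l k := by
  have hne : S.Nonempty := Finset.card_pos.1 (by omega)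
  obtain ⟨k, hk, hmax⟩ := Finset.exists_max_image S l hne
  refine ⟨k, S.erase k, Finset.notMem_erase k S, (Finset.insert_erase hk).symm, ?_, hmax⟩
  rw [Finset.card_erase_of_mem hk, hS]; rfl

theorem OS_sub_insert {X : Type v} [MetricSpace X] {Γ : Type u} [Group Γ] [MulAction Γ X] {m : ℕ}
    (V : Subgroup Γ) (A : Set X) (t : Fin m → Γ) (S : Finset (Fin m)) (k : Fin m) :
    (∀ g ∈ Subgroup.closure ((KS V t S : Set Γ) ∪ {t k}), g • OS V A t S ⊆ OS V A t (insert k S)) ∧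
    (∀ x ∈ OS V A t (insert k S), ∃ g ∈ Subgroup.closure ((KS V t S : Set Γ) ∪ {t k}),
      x ∈ g • OS V A t S) ∧
    (∀ g ∈ Subgroup.closure ((KS V t S : Set Γ) ∪ {t k}),
      g • OS V A t (insert k S) = OS V A t (insert k S)) := by
  rw [← KS_insert]
  refine ⟨?_, ?_, fun g hg => OS_inv V A t _ hg⟩
  · rintro g hg _ ⟨x, ⟨h, hh, hx⟩, rfl⟩
    refine ⟨g * h, Subgroup.mul_mem _ hg ?_, ?_⟩
    · rw [KS_insert]; exact Subgroup.subset_closure (Or.inl hh)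
    · rw [mul_smul]; exact smul_mem_smul_set hx
  · rintro x ⟨g, hg, hx⟩
    exact ⟨g, hg, smul_set_mono (subset_OS V A t S) hx⟩

/-- the data available at each inductive step -/
theorem step_setup {m n : ℕ} (ih2 : IH2.{u, v} m n) (ih3 : IH3.{u, v} m n) :
    ∃ T0 T : ℝ, 0 ≤ T0 ∧ 0 ≤ T ∧ ∀ R' : ℝ, 2 * (T0 + T + 66) + 7 ≤ R' → ∃ R1 : ℝ,
    ∀ (Γ : Type u) (X : Type v) [MetricSpace X] [Group Γ] [MulAction Γ X]
    (V : Subgroup Γ) (A : Set X) (t : Fin m → Γ) (l : Fin m → ℝ) (R : ℝ),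
    Cfg V A t l R → R1 ≤ R → ∀ S : Finset (Fin m), S.card = n → ∀ k ∉ S, (∀ j ∈ S, l j ≤ l k) →
    Dip (OS V A t S) (l k / 2 - (T0 + 40)) T ∧ Dip (OS V A t S) (l k / 2) T0 ∧
    R' ≤ l k / 2 - 2 ∧ 0 ≤ l k ∧
    ∃ z, StepCfg (KS V t S) (OS V A t S) (t k) (l k) R' z := by
  obtain ⟨T0, hT0, r1, h1⟩ := ih2 0 le_rfl
  obtain ⟨T, hT, r2, h2⟩ := ih2 (T0 + 40) (by linarith)
  refine ⟨T0, T, hT0, hT, fun R' hR' => ?_⟩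
  obtain ⟨r3, h3⟩ := stepCfg_exists ih3 R' (by linarith)
  refine ⟨max (max r1 r2) (max r3 (2 * R' + 4)), ?_⟩
  intro Γ X _ _ _ V A t l R h hR S hS k hk hmax
  have hRa : r1 ≤ R := ((le_max_left _ _).trans (le_max_left _ _)).trans hR
  have hRb : r2 ≤ R := ((le_max_right _ _).trans (le_max_left _ _)).trans hR
  have hRc : r3 ≤ R := ((le_max_left _ _).trans (le_max_right _ _)).trans hR
  have hRd : 2 * R' + 4 ≤ R := ((le_max_right _ _).trans (le_max_right _ _)).trans hR
  have hlk := h.lR k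
  refine ⟨h2 Γ X V A t l R h hRb S hS (l k) hlk hmax, ?_, by linarith, by linarith,
    h3 Γ X V A t l R h hRc S hS k hk⟩
  have := h1 Γ X V A t l R h hRa S hS (l k) hlk hmax
  rwa [sub_zero] at this

theorem IH2_succ {m n : ℕ} (ih2 : IH2.{u, v} m n) (ih3 : IH3.{u, v} m n) :
    IH2.{u, v} m (n + 1) := by
  intro c hc
  obtain ⟨T0, T, hT0, hT, hset⟩ := step_setup ih2 ih3
  have hch : cHat c (T0 + T + 66) = c + 4 * (T0 + T + 66 + 8) + 20 := rfl
  obtain ⟨Th, hTh, r1, hdh⟩ := ih2 (cHat c (T0 + T + 66)) (by linarith)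
  have hcb : cB c (T0 + T + 66) Th = 2 * (cHat c (T0 + T + 66) + 5 * (T0 + T + 66 + 8) + 10)
        + Th + 4 * (T0 + T + 66 + 8) + 16 := rfl
  obtain ⟨r2, hr2⟩ := hset (3 * cB c (T0 + T + 66) Th + 2 * (T0 + T + 66 + 8) + 1 +
    2 * (T0 + T + 66) + 7) (by linarith)
  refine ⟨4 * cB c (T0 + T + 66) Th, by linarith, max r1 r2, ?_⟩
  intro Γ X _ _ _ V A t l R h hR S hS lam hlam hle
  obtain ⟨k, S0, hk, rfl, hS0, hmax⟩ := chooseK l hS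
  have hmax0 : ∀ j ∈ S0, l j ≤ l k := fun j hj => hmax j (Finset.mem_insert_of_mem hj)
  obtain ⟨d1, d2, hRl, hl, z, St⟩ := hr2 Γ X V A t l R h ((le_max_right _ _).trans hR) S0 hS0 k hk hmax0
  have d3 := hdh Γ X V A t l R h ((le_max_left _ _).trans hR) S0 hS0 (l k) (h.lR k) hmax0
  obtain ⟨o1, o2, o3⟩ := OS_sub_insert V A t S0 k
  have := St.dip_step hl hT hT0 hTh hc d1 d2 d3 (by linarith) hRl (by linarith) o1 o2 o3
  refine this.mono ?_
  have := hle k (Finset.mem_insert_self _ _)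
  linarith

theorem IH5_succ {m n : ℕ} (ih2 : IH2.{u, v} m n) (ih3 : IH3.{u, v} m n) (ih5 : IH5.{u, v} m n) :
    IH5.{u, v} m (n + 1) := by
  obtain ⟨T0, T, hT0, hT, hset⟩ := step_setup ih2 ih3
  obtain ⟨r1, hr1⟩ := hset (4 * (T0 + T + 66) + 21) (by linarith)
  obtain ⟨r2, hr2⟩ := ih5
  refine ⟨max (max r1 r2) 1, ?_⟩
  intro Γ X _ _ _ V A t l R h hR S hS w hw hx
  have hRa : r1 ≤ R := ((le_max_left _ _).trans (le_max_left _ _)).trans hR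
  have hRb : r2 ≤ R := ((le_max_right _ _).trans (le_max_left _ _)).trans hR
  have hRc : 1 ≤ R := (le_max_right _ _).trans hR
  obtain ⟨k, S0, hk, rfl, hS0, hmax⟩ := chooseK l hS
  have hmax0 : ∀ j ∈ S0, l j ≤ l k := fun j hj => hmax j (Finset.mem_insert_of_mem hj)
  obtain ⟨d1, d2, hRl, hl, z, St⟩ := hr1 Γ X V A t l R h hRa S0 hS0 k hk hmax0
  rw [KS_insert] at hw
  obtain ⟨N, e, hp⟩ := exists_path _ _ hw
  obtain ⟨a, ha⟩ := h.OS_ne S0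
  rcases Nat.lt_or_ge N 2 with hN | hN
  · interval_cases N
    · exact hr2 Γ X V A t l R h hRb S0 hS0 w (hp.zero rfl) hx
    · exfalso
      have := St.one_word (R := R) (fun g1 hg1 g2 hg2 x =>
        h.disp k g1 (KS_le V t hk hg1) g2 (KS_le V t hk hg2) x) hp a
      rw [hx, dist_self] at this
      linarith
  · exfalso
    have hb : a ∈ w • OS V A t S0 := by
      have := smul_mem_smul_set (a := w) ha
      rwa [hx] at this
    have hch := St.chain hl hT hT0 d1 d2 (by linarith) hRl hp (by omega) ha hb
    have := St.long_word (by linarith) (by linarith) hp hN ha hb hch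
    rw [dist_self] at this
    linarith

theorem IH3_succ {m n : ℕ} (ih2 : IH2.{u, v} m n) (ih3 : IH3.{u, v} m n) :
    IH3.{u, v} m (n + 1) := by
  intro T hT
  obtain ⟨T0, T', hT0, hT', hset⟩ := step_setup ih2 ih3
  obtain ⟨T1, hT1, r0, hdip⟩ := IH2_succ ih2 ih3 0 le_rfl
  obtain ⟨D, r3, hD⟩ := ih3 T hT
  obtain ⟨r1, hr1⟩ := hset (2 * (T + 2 * (T0 + T' + 66) + 16 + T1)) (by linarith)
  refine ⟨D, max (max r1 r0) (max r3 (T + 1)), ?_⟩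
  intro Γ X _ _ _ V A t l R h hR S hS w hw hne x hx
  have hRa : r1 ≤ R := ((le_max_left _ _).trans (le_max_left _ _)).trans hR
  have hRb : r0 ≤ R := ((le_max_right _ _).trans (le_max_left _ _)).trans hR
  have hRc : r3 ≤ R := ((le_max_left _ _).trans (le_max_right _ _)).trans hR
  have hRd : T + 1 ≤ R := ((le_max_right _ _).trans (le_max_right _ _)).trans hR
  obtain ⟨o, ⟨g, hg, ⟨a, ha, rfl⟩⟩, ho⟩ := exists_close (h.OS_ne S)
    (show infDist x (OS V A t S) < infDist x (OS V A t S) + 1 by linarith)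
  have einf : infDist x (OS V A t S) = infDist (g⁻¹ • x) (OS V A t S) := by
    rw [← h.iso.infDist_inv, OS_inv V A t S hg]
  rw [einf] at ho ⊢
  have ho : dist a (g⁻¹ • x) ≤ infDist (g⁻¹ • x) (OS V A t S) + 1 := by
    rw [← h.iso.dist_left, dist_comm]; exact ho
  have hx : dist (g⁻¹ • x) ((g⁻¹ * w * g) • g⁻¹ • x) ≤ T := by
    rw [mul_smul, smul_inv_smul, mul_smul, h.iso]; exact hx
  have hw : g⁻¹ * w * g ∈ KS V t S :=
    Subgroup.mul_mem _ (Subgroup.mul_mem _ (Subgroup.inv_mem _ hg) hw) hg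
  have hne : g⁻¹ * w * g ≠ 1 := fun he => hne (by
    have : w = g * (g⁻¹ * w * g) * g⁻¹ := by group
    rw [this, he]; group)
  generalize g⁻¹ • x = x at *
  generalize g⁻¹ * w * g = w at *
  obtain ⟨k, S0, hk, rfl, hS0, hmax⟩ := chooseK l hS
  have hmax0 : ∀ j ∈ S0, l j ≤ l k := fun j hj => hmax j (Finset.mem_insert_of_mem hj)
  obtain ⟨d1, d2, hRl, hl, z, St⟩ := hr1 Γ X V A t l R h hRa S0 hS0 k hk hmax0
  have hwS := hw
  rw [KS_insert] at hw
  obtain ⟨N, e, hp⟩ := exists_path _ _ hw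
  have haO := subset_OS V A t S0 ha
  obtain ⟨o1, o2, o3⟩ := OS_sub_insert V A t S0 k
  rcases Nat.lt_or_ge N 2 with hN | hN
  · interval_cases N
    · have := hD Γ X V A t l R h hRc S0 hS0 w (hp.zero rfl) hne x hx
      refine le_trans (infDist_le_infDist_of_subset ?_ (h.OS_ne S0)) this
      have := o1 1 (Subgroup.one_mem _)
      rwa [one_smul] at this
    · exfalso
      have := St.one_word (R := R) (fun g1 hg1 g2 hg2 x =>
        h.disp k g1 (KS_le V t hk hg1) g2 (KS_le V t hk hg2) x) hp x
      linarith
  · exfalso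
    have hb : w • a ∈ w • OS V A t S0 := smul_mem_smul_set haO
    have hch := St.chain hl hT' hT0 d1 d2 (by linarith) hRl hp (by omega) haO hb
    have hlen := St.long_word (by linarith) (by linarith) hp hN haO hb hch
    obtain ⟨β, hβ⟩ := h.geo a (w • a)
    have tr := dist_triangle (w • a) (w • x) x
    have c1 := dist_comm (w • x) x
    have ei := h.iso w a x
    obtain ⟨hm, hmd⟩ := midPt h.fp hβ hT (x := x) (by linarith)
    have hD2 := hdip Γ X V A t l R h hRb (insert k S0) hS (l k) (h.lR k) hmax
    rw [sub_zero] at hD2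
    have haS := subset_OS V A t (insert k S0) ha
    have hwa : w • a ∈ OS V A t (insert k S0) := ⟨w, hwS, smul_mem_smul_set ha⟩
    have q := hD2.all (by linarith) hT1 haS hwa hβ hm
    have iu := infDist_le_add (O := OS V A t (insert k S0)) (x := x) (y := β (dist a (w • a) / 2))
    linarith

theorem all_IH (m : ℕ) (hm : 1 ≤ m) (n : ℕ) :
    IH2.{u, v} m n ∧ IH3.{u, v} m n ∧ IH5.{u, v} m n := by
  induction n with
  | zero => exact ⟨IH2_zero m, IH3_zero m, IH5_zero m hm⟩
  | succ n ih => exact ⟨IH2_succ ih.1 ih.2.1, IH3_succ ih.1 ih.2.1, IH5_succ ih.1 ih.2.1 ih.2.2⟩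

end KW

namespace KW

open Metric Set Pointwise

section hull

variable {X : Type*} [MetricSpace X]

theorem mem_geoConv (hs : StronglyGeodesic X) {S : Set (X ⊕ Boundary X)} {x : X}
    (hx : Sum.inl x ∈ S) : x ∈ geoConv S := by
  by_cases h : S = {Sum.inl x}
  · exact Or.inl ⟨x, h, rfl⟩
  · have : ∃ q ∈ S, q ≠ Sum.inl x := by
      by_contra hc
      push Not at hc
      exact h (Subset.antisymm (fun q hq => hc q hq) (by rintro _ rfl; exact hx))
    obtain ⟨q, hq, hne⟩ := this
    refine Or.inr ⟨Sum.inl x, hx, q, hq, hne.symm, ?_⟩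
    rcases q with y | p
    · obtain ⟨γ, hγ⟩ := geo_of_geodesicSpace hs.1 x y
      exact ⟨_, hγ.seg, 0, ⟨le_rfl, hγ.1⟩, hγ.2.1⟩
    · obtain ⟨γ, rfl⟩ := Quotient.exists_rep p
      obtain ⟨γ', h1, h2, h3⟩ := hs.2.1 γ.1 γ.2 x
      exact ⟨_, ⟨γ', h2, ⟨h1, Quotient.sound (asymptotic_symm h3)⟩, rfl⟩, 0, by simp, h2⟩

variable {G : Type*} [Group G] [MulAction G X]

theorem ray_smul (iso : IsometricAction G X) (g : G) {γ : ℝ → X} (h : IsGeodesicRay γ) :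
    IsGeodesicRay (fun t => g • γ t) := fun s t hs ht => by
  rw [iso]; exact h s t hs ht

theorem asym_smul (iso : IsometricAction G X) (g : G) {γ γ' : ℝ → X} (h : Asymptotic γ γ') :
    Asymptotic (fun t => g • γ t) (fun t => g • γ' t) := by
  obtain ⟨K, h1, h2⟩ := h
  refine ⟨K, ?_, ?_⟩
  · rintro _ ⟨s, hs, rfl⟩
    obtain ⟨_, ⟨t, ht, rfl⟩, hd⟩ := h1 _ ⟨s, hs, rfl⟩
    exact ⟨_, ⟨t, ht, rfl⟩, by simpa only [iso g] using hd⟩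
  · rintro _ ⟨s, hs, rfl⟩
    obtain ⟨_, ⟨t, ht, rfl⟩, hd⟩ := h2 _ ⟨s, hs, rfl⟩
    exact ⟨_, ⟨t, ht, rfl⟩, by simpa only [iso g] using hd⟩

def gB (iso : IsometricAction G X) (g : G) : Boundary X → Boundary X :=
  Quotient.map (fun γ : GRay X => (⟨fun t => g • γ.1 t, ray_smul iso g γ.2⟩ : GRay X))
    (fun _ _ h => asym_smul iso g h)

theorem gB_mk (iso : IsometricAction G X) (g : G) (γ : GRay X) :
    gB iso g (Boundary.mk γ) = Boundary.mk ⟨fun t => g • γ.1 t, ray_smul iso g γ.2⟩ := rfl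

theorem gB_inv (iso : IsometricAction G X) (g : G) (p : Boundary X) :
    gB iso g⁻¹ (gB iso g p) = p := by
  obtain ⟨γ, rfl⟩ := Quotient.exists_rep p
  change gB iso g⁻¹ (gB iso g (Boundary.mk γ)) = Boundary.mk γ
  refine congrArg Boundary.mk (Subtype.ext ?_)
  funext t
  exact inv_smul_smul g (γ.1 t)

def gS (iso : IsometricAction G X) (g : G) : X ⊕ Boundary X → X ⊕ Boundary X :=
  Sum.map (fun x => g • x) (gB iso g)

theorem gS_inv (iso : IsometricAction G X) (g : G) (p : X ⊕ Boundary X) :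
    gS iso g⁻¹ (gS iso g p) = p := by
  rcases p with x | p
  · simp [gS]
  · simp [gS, gB_inv]

theorem seqConv_smul (iso : IsometricAction G X) (g : G) {x : X} {u : ℕ → X} {p : Boundary X}
    (h : SeqConvTo x u p) : SeqConvTo (g • x) (fun n => g • u n) (gB iso g p) := by
  obtain ⟨γ, rfl, h⟩ := h
  refine ⟨⟨fun t => g • γ.1 t, ray_smul iso g γ.2⟩, (gB_mk iso g γ).symm, fun M => ?_⟩
  obtain ⟨N, hN⟩ := h M
  refine ⟨N, fun n hn k hk => ?_⟩
  have := hN n hn k hk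
  simpa only [gromov, iso g] using this

theorem joinSet_smul (iso : IsometricAction G X) (g : G) {p q : X ⊕ Boundary X} {s : Set X}
    (h : JoinSet p q s) : JoinSet (gS iso g p) (gS iso g q) ((fun x => g • x) '' s) := by
  have ray : ∀ (γ : ℝ → X) (p : Boundary X), RayTo γ p → RayTo (fun t => g • γ t) (gB iso g p) := by
    rintro γ p ⟨h1, rfl⟩
    exact ⟨ray_smul iso g h1, rfl⟩
  rcases p with x | p <;> rcases q with y | q
  · obtain ⟨b, f, hb, h0, h1, h2, rfl⟩ := h
    exact ⟨b, fun t => g • f t, hb, by simp [h0], by simp [h1],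
      fun u hu v hv => by rw [iso]; exact h2 u hu v hv, by rw [image_image]⟩
  · obtain ⟨γ, h0, h1, rfl⟩ := h
    exact ⟨fun t => g • γ t, by simp [h0], ray _ _ h1, by rw [image_image]⟩
  · obtain ⟨γ, h0, h1, rfl⟩ := h
    exact ⟨fun t => g • γ t, by simp [h0], ray _ _ h1, by rw [image_image]⟩
  · obtain ⟨γ, ⟨h0, h1, h2⟩, rfl⟩ := h
    refine ⟨fun t => g • γ t, ⟨fun s t => by rw [iso]; exact h0 s t, seqConv_smul iso g h1,
      seqConv_smul iso g h2⟩, ?_⟩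
    exact (range_comp (fun x : X => g • x) γ).symm

theorem conv_inv (hs : StronglyGeodesic X) (iso : IsometricAction G X) (g : G)
    {S : Set (X ⊕ Boundary X)} (hS : ∀ p ∈ S, gS iso g p ∈ S) {x : X} (hx : x ∈ geoConv S) :
    g • x ∈ geoConv S := by
  rcases hx with ⟨a, ha, rfl⟩ | ⟨p, hp, q, hq, hpq, s, hj, hxs⟩
  · exact mem_geoConv hs (hS (Sum.inl x) (by rw [ha]; rfl))
  · refine Or.inr ⟨_, hS p hp, _, hS q hq, fun h => hpq ?_, _, joinSet_smul iso g hj, x, hxs, rfl⟩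
    rw [← gS_inv iso g p, h, gS_inv]

theorem ZSet_inv (hs : StronglyGeodesic X) (iso : IsometricAction G X) (V : Subgroup G) {g : G}
    (hg : g ∈ V) {x : X} (hx : x ∈ ZSet X 1 V) : g • x ∈ ZSet X 1 V := by
  refine conv_inv hs iso g ?_ hx
  rintro _ (⟨p, ⟨x₀, w, hw⟩, rfl⟩ | ⟨y, ⟨w, hw, hw1, hd⟩, rfl⟩)
  · refine Or.inl ⟨_, ⟨g • x₀, fun n => ⟨g, hg⟩ * w n * ⟨g, hg⟩⁻¹, ?_⟩, rfl⟩
    have := seqConv_smul iso g hw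
    convert this using 2 with n
    simp [mul_smul]
  · refine Or.inr ⟨_, ⟨g * w * g⁻¹, V.mul_mem (V.mul_mem hg hw) (V.inv_mem hg), ?_, ?_⟩, rfl⟩
    · simpa using hw1
    · rw [mul_smul, mul_smul, inv_smul_smul, iso]; exact hd

theorem cHull_inv_sub (hs : StronglyGeodesic X) (iso : IsometricAction G X) (V : Subgroup G) {g : G}
    (hg : g ∈ V) {x : X} (hx : x ∈ cHull X 1 V) : g • x ∈ cHull X 1 V := by
  have hc : Continuous (fun x : X => g • x) := (Isometry.of_dist_eq (iso g)).continuous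
  refine MapsTo.closure (f := fun x : X => g • x) ?_ hc hx
  intro y hy
  refine conv_inv hs iso g ?_ hy
  rintro _ ⟨z, hz, rfl⟩
  exact ⟨_, ZSet_inv hs iso V hg hz, rfl⟩

theorem cHull_inv (hs : StronglyGeodesic X) (iso : IsometricAction G X) (V : Subgroup G) {g : G}
    (hg : g ∈ V) : g • cHull X 1 V = cHull X 1 V := by
  apply Subset.antisymm
  · rintro _ ⟨x, hx, rfl⟩
    exact cHull_inv_sub hs iso V hg hx
  · intro x hx
    exact ⟨g⁻¹ • x, cHull_inv_sub hs iso V (V.inv_mem hg) hx, smul_inv_smul g x⟩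

theorem cHull_sd (hs : StronglyGeodesic X) (V : Subgroup G) {g : G}
    (hg : g ∈ V) (hg1 : g ≠ 1) {x : X} (hx : dist x (g • x) ≤ 100) : x ∈ cHull X 1 V := by
  refine subset_closure (mem_geoConv hs ⟨x, ?_, rfl⟩)
  exact mem_geoConv hs (Or.inr ⟨x, ⟨g, hg, hg1, by linarith⟩, rfl⟩)

theorem seg_rev {s : Set X} {x y : X} (h : IsGeodesicSegment s x y) : IsGeodesicSegment s y x := by
  obtain ⟨b, f, hb, h0, h1, h2, rfl⟩ := h
  refine ⟨b, fun t => f (b - t), hb, by simpa using h1, by simpa using h0, ?_, ?_⟩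
  · intro u hu v hv
    rw [h2 _ ⟨by linarith [hu.2], by linarith [hu.1]⟩ _ ⟨by linarith [hv.2], by linarith [hv.1]⟩]
    rw [show b - u - (b - v) = -(u - v) by ring, abs_neg]
  · ext z
    constructor
    · rintro ⟨t, ht, rfl⟩
      exact ⟨b - t, ⟨by linarith [ht.2], by linarith [ht.1]⟩, by simp⟩
    · rintro ⟨t, ht, rfl⟩
      exact ⟨b - t, ⟨by linarith [ht.2], by linarith [ht.1]⟩, by simp⟩

theorem seg_ZZ (hs : StronglyGeodesic X) {Z : Set X} {z z' : X} (hz : z ∈ Z) (hz' : z' ∈ Z)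
    {s : Set X} (h : IsGeodesicSegment s z z') :
    s ⊆ geoConv (Sum.inl '' Z : Set (X ⊕ Boundary X)) := by
  intro w hw
  by_cases e : z = z'
  · subst e
    obtain ⟨b, f, hb, h0, h1, h2, rfl⟩ := h
    obtain ⟨t, ht, rfl⟩ := hw
    have hb0 : b = 0 := by
      have := h2 0 ⟨le_rfl, hb⟩ b ⟨hb, le_rfl⟩
      rw [h0, h1, dist_self, zero_sub, abs_neg, abs_of_nonneg hb] at this
      exact this.symm
    have : t = 0 := le_antisymm (hb0 ▸ ht.2) ht.1
    rw [this, h0]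
    exact mem_geoConv hs ⟨z, hz, rfl⟩
  · exact Or.inr ⟨_, ⟨z, hz, rfl⟩, _, ⟨z', hz', rfl⟩, fun h => e (Sum.inl.inj h), s, h, hw⟩

theorem seg_to_Z (hs : StronglyGeodesic X) {Z : Set X} {a : X}
    (ha : a ∈ geoConv (Sum.inl '' Z : Set (X ⊕ Boundary X))) :
    ∃ z ∈ Z, ∃ s, IsGeodesicSegment s a z ∧ s ⊆ geoConv (Sum.inl '' Z : Set (X ⊕ Boundary X)) := by
  rcases ha with ⟨b, hb, rfl⟩ | ⟨_, ⟨z, hz, rfl⟩, _, ⟨z', hz', rfl⟩, hne, s, hj, has⟩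
  · have : a ∈ Z := by
      have : (Sum.inl a : X ⊕ Boundary X) ∈ Sum.inl '' Z := by rw [hb]; rfl
      obtain ⟨c, hc, h⟩ := this
      rw [← Sum.inl.inj h]; exact hc
    obtain ⟨s, h⟩ := hs.1 a a
    exact ⟨a, this, s, h, seg_ZZ hs this this h⟩
  · have hsub := seg_ZZ hs hz hz' hj
    obtain ⟨b, f, hb, h0, h1, h2, rfl⟩ := hj
    obtain ⟨t, ht, rfl⟩ := has
    refine ⟨z, hz, f '' Icc 0 t, seg_rev ⟨t, f, ht.1, h0, rfl, ?_, rfl⟩, ?_⟩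
    · intro u hu v hv
      exact h2 u ⟨hu.1, hu.2.trans ht.2⟩ v ⟨hv.1, hv.2.trans ht.2⟩
    · exact (image_mono (Icc_subset_Icc_right ht.2)).trans hsub

theorem cHull_qc (hs : StronglyGeodesic X) (hX : DeltaHyperbolic 1 X) (V : Subgroup G)
    (γ : ℝ → X) (L : ℝ) (a b : X) (ha : a ∈ cHull X 1 V) (hb : b ∈ cHull X 1 V)
    (hγ : GeodParam γ L a b) (τ : ℝ) (hτ : τ ∈ Icc 0 L) : infDist (γ τ) (cHull X 1 V) ≤ 20 := by
  have hfp := fp_of_hyp hX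
  obtain ⟨a', ha', hda⟩ := Metric.mem_closure_iff.1 ha 1 one_pos
  obtain ⟨b', hb', hdb⟩ := Metric.mem_closure_iff.1 hb 1 one_pos
  obtain ⟨z, hz, s, hs1, hsub⟩ := seg_to_Z hs ha'
  obtain ⟨z', hz', s', hs1', hsub'⟩ := seg_to_Z hs hb'
  obtain ⟨β, hβ⟩ := geo_of_geodesicSpace hs.1 a' b'
  obtain ⟨σ, hσ, hd⟩ := near hfp hβ (γ τ)
  have e1 := hγ.left hτ
  have e2 := hγ.right hτ
  have e3 := hγ.len
  have t1 := dist_triangle (γ τ) a a'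
  have t2 := dist_triangle (γ τ) b b'
  have t3 := dist_triangle a a' b
  have t4 := dist_triangle a' b' b
  have hd6 : dist (γ τ) (β σ) ≤ 6 := by
    rw [dist_comm b' b] at t4
    have q1 : dist (γ τ) a = τ := by first | exact e1 | (rw [dist_comm]; exact e1)
    have q2 : dist (γ τ) b = L - τ := by first | exact e2 | (rw [dist_comm]; exact e2)
    linarith
  obtain ⟨c, hc⟩ := hs.1 a' z'
  obtain ⟨c', hc'⟩ := hs.1 z z'
  have key : ∃ q ∈ geoConv (Sum.inl '' ZSet X 1 V : Set (X ⊕ Boundary X)), dist (β σ) q ≤ 2 := by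
    obtain ⟨q, hq | hq, hdq⟩ := hX.2 a' b' z' _ _ _ hβ.seg hs1' hc (β σ) ⟨σ, hσ, rfl⟩
    · exact ⟨q, hsub' hq, by linarith⟩
    · obtain ⟨q', hq', hdq'⟩ := hX.2 a' z' z _ _ _ hc (seg_rev hc') hs1 q hq
      refine ⟨q', ?_, by linarith [dist_triangle (β σ) q q']⟩
      rcases hq' with h | h
      · exact seg_ZZ hs hz hz' hc' h
      · exact hsub h
  obtain ⟨q, hq, hdq⟩ := key
  have : infDist (γ τ) (cHull X 1 V) ≤ dist (γ τ) q := infDist_le_dist_of_mem (x := γ τ) (subset_closure hq : q ∈ cHull X 1 V)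
  linarith [dist_triangle (γ τ) (β σ) q]

end hull


section reduction

variable {G : Type u} [Group G] {X : Type v} [MetricSpace X] [MulAction G X] {m : ℕ}

def inV (V : Subgroup G) (m : ℕ) : V →* Monoid.CoprodI (FF m (fun _ : Fin 1 => V)) :=
  (Monoid.CoprodI.of (M := FF m (fun _ : Fin 1 => V)) (i := Sum.inl 0) : _ →* _)

def inT (V : Subgroup G) (m : ℕ) (k : Fin m) : Monoid.CoprodI (FF m (fun _ : Fin 1 => V)) :=
  (Monoid.CoprodI.of (M := FF m (fun _ : Fin 1 => V)) (i := Sum.inr k) : _ →* _)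
    (FreeGroup.of PUnit.unit : FreeGroup PUnit)

theorem hom_inV (V : Subgroup G) (H : Fin m → G) (v : V) :
    freeProdHom (fun _ : Fin 1 => V) H (inV V m v) = v :=
  Monoid.CoprodI.lift_of (ffHoms (fun _ : Fin 1 => V) H) (i := Sum.inl 0) v

theorem hom_inT (V : Subgroup G) (H : Fin m → G) (k : Fin m) :
    freeProdHom (fun _ : Fin 1 => V) H (inT V m k) = H k := by
  refine (Monoid.CoprodI.lift_of (ffHoms (fun _ : Fin 1 => V) H) (i := Sum.inr k)
    (FreeGroup.of PUnit.unit : FreeGroup PUnit)).trans ?_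
  exact FreeGroup.lift_apply_of

theorem gen_top (V : Subgroup G) (m : ℕ) :
    Subgroup.closure (((inV V m).range : Set (Monoid.CoprodI (FF m (fun _ : Fin 1 => V)))) ∪
      range (inT V m)) = ⊤ := by
  rw [eq_top_iff]
  intro w _
  induction w using Monoid.CoprodI.induction_on with
  | one => exact Subgroup.one_mem _
  | mul x y hx hy => exact Subgroup.mul_mem _ (hx trivial) (hy trivial)
  | of i x =>
    rcases i with j | k
    · obtain rfl : j = 0 := Subsingleton.elim _ _
      exact Subgroup.subset_closure (Or.inl ⟨x, rfl⟩)
    · let ι : FreeGroup PUnit →* Monoid.CoprodI (FF m (fun _ : Fin 1 => V)) :=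
        (Monoid.CoprodI.of (M := FF m (fun _ : Fin 1 => V)) (i := Sum.inr k) : _ →* _)
      have key : ∀ y : FreeGroup PUnit, ι y ∈
          Subgroup.closure (((inV V m).range :
            Set (Monoid.CoprodI (FF m (fun _ : Fin 1 => V)))) ∪ range (inT V m)) := by
        intro y
        induction y using FreeGroup.induction_on with
        | C1 => rw [map_one]; exact Subgroup.one_mem _
        | of a => exact Subgroup.subset_closure (Or.inr ⟨k, rfl⟩)
        | inv_of a h => rw [map_inv]; exact Subgroup.inv_mem _ h
        | mul a b ha hb => rw [map_mul]; exact Subgroup.mul_mem _ ha hb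
      exact key x

theorem hom_mem (V : Subgroup G) (H : Fin m → G) (k : Fin m)
    {g : Monoid.CoprodI (FF m (fun _ : Fin 1 => V))}
    (hg : g ∈ Subgroup.closure (((inV V m).range :
      Set (Monoid.CoprodI (FF m (fun _ : Fin 1 => V)))) ∪ inT V m '' {j | j ≠ k})) :
    freeProdHom (fun _ : Fin 1 => V) H g ∈
      Subgroup.closure (H '' {j : Fin m | j ≠ k} ∪ ⋃ _t : Fin 1, (V : Set G)) := by
  have : g ∈ (Subgroup.closure (H '' {j : Fin m | j ≠ k} ∪ ⋃ _t : Fin 1, (V : Set G))).comap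
      (freeProdHom (fun _ : Fin 1 => V) H) := by
    refine (Subgroup.closure_le _).2 ?_ hg
    rintro _ (⟨v, rfl⟩ | ⟨j, hj, rfl⟩)
    · rw [SetLike.mem_coe, Subgroup.mem_comap, hom_inV]
      exact Subgroup.subset_closure (Or.inr (mem_iUnion.2 ⟨0, v.2⟩))
    · rw [SetLike.mem_coe, Subgroup.mem_comap, hom_inT]
      exact Subgroup.subset_closure (Or.inl ⟨j, hj, rfl⟩)
  exact this

theorem equiv_update (V : Subgroup G) (H : Fin m → G) (k : Fin m) {g1 g2 : G}
    (h1 : g1 ∈ Subgroup.closure (H '' {j : Fin m | j ≠ k} ∪ ⋃ _t : Fin 1, (V : Set G)))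
    (h2 : g2 ∈ Subgroup.closure (H '' {j : Fin m | j ≠ k} ∪ ⋃ _t : Fin 1, (V : Set G))) :
    gEquiv ((fun _ : Fin 1 => V), H)
      ((fun _ : Fin 1 => V), Function.update H k (g1 * H k * g2)) :=
  Relation.ReflTransGen.single (Or.inr ⟨rfl, k, g1, g2, h1, h2,
    fun j hj => Function.update_of_ne hj _ _, Function.update_self _ _ _⟩)

theorem lV_le (V : Subgroup G) (g : G) {a b : X} (ha : a ∈ cHull X 1 V) (hb : b ∈ cHull X 1 V) :
    lV X 1 V g ≤ dist a (g • b) := by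
  refine csInf_le ⟨0, ?_⟩ ⟨a, ha, g • b, ⟨b, hb, rfl⟩, rfl⟩
  rintro _ ⟨x, _, y, _, rfl⟩
  exact dist_nonneg

theorem lV_ex (V : Subgroup G) (g : G) (hA : (cHull X 1 V).Nonempty) :
    ∃ a ∈ cHull X 1 V, ∃ b ∈ cHull X 1 V, dist a (g • b) ≤ lV X 1 V g + 1 := by
  have hne : (image2 dist (cHull X 1 V) (g • cHull X 1 V)).Nonempty :=
    hA.image2 (hA.image _)
  obtain ⟨_, ⟨a, ha, _, ⟨b, hb, rfl⟩, rfl⟩, h⟩ :=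
    exists_lt_of_csInf_lt hne (lt_add_one (lV X 1 V g))
  exact ⟨a, ha, b, hb, h.le⟩

theorem min_low (V : Subgroup G) (H : Fin m → G) (hmin : PairMinimal X V H) (k : Fin m) {g : G}
    (he : gEquiv ((fun _ : Fin 1 => V), H) ((fun _ : Fin 1 => V), Function.update H k g)) :
    lV X 1 V (H k) ≤ lV X 1 V g + 1 := by
  have h := hmin V _ he
  have e1 := Finset.add_sum_erase Finset.univ (fun i => lV X 1 V (H i)) (Finset.mem_univ k)
  have e2 := Finset.add_sum_erase Finset.univ
    (fun i => lV X 1 V (Function.update H k g i)) (Finset.mem_univ k)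
  have e3 : ∑ i ∈ Finset.univ.erase k, lV X 1 V (Function.update H k g i) =
      ∑ i ∈ Finset.univ.erase k, lV X 1 V (H i) := by
    refine Finset.sum_congr rfl fun i hi => ?_
    rw [Function.update_of_ne (Finset.ne_of_mem_erase hi)]
  simp only [Function.update_self] at e2
  linarith

end reduction

theorem statement4_aux (m : ℕ) (hm : 1 ≤ m) :
    ∃ R : ℝ, 0 < R ∧ ∀ (G : Type u) (X : Type v)
      [Group G] [MetricSpace X] [MulAction G X],
      IsometricAction G X → StronglyGeodesic X → DeltaHyperbolic 1 X →
      ∀ (V : Subgroup G) (H : Fin m → G), V ≠ ⊥ → PairMinimal X V H →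
        IsFreeProdDecomp (fun _ : Fin 1 => V) H
          (Subgroup.closure ((V : Set G) ∪ Set.range H)) ∨
        ∃ (V' : Subgroup G) (H' : Fin m → G),
          gEquiv ((fun _ : Fin 1 => V), H) ((fun _ : Fin 1 => V'), H') ∧
          ((∃ i : Fin m, lV X 1 V' (H' i) ≤ R) ∨
           (∃ (i : Fin m) (x : X), dist x (H' i • x) ≤ R)) := by
  obtain ⟨R1, hR1⟩ := (all_IH.{u, v} m hm m).2.2
  refine ⟨max R1 1, lt_max_of_lt_right one_pos, ?_⟩
  intro G X _ _ _ iso hs hX V H _ hmin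
  by_contra hcon
  push Not at hcon
  obtain ⟨hnot, hcon⟩ := hcon
  have hlR : ∀ k, max R1 1 < lV X 1 V (H k) := fun k =>
    (hcon V H Relation.ReflTransGen.refl).1 k
  have hA : (cHull X 1 V).Nonempty := by
    rw [nonempty_iff_ne_empty]
    intro hA
    have h1 := hlR ⟨0, hm⟩
    have h2 := le_max_right R1 1
    rw [lV, setDist, hA, image2_empty_left, Real.sInf_empty] at h1
    linarith
  set φ := freeProdHom (fun _ : Fin 1 => V) H with hφ
  let act : MulAction (Monoid.CoprodI (FF m (fun _ : Fin 1 => V))) X := MulAction.compHom X φ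
  have hact : ∀ (g : Monoid.CoprodI (FF m (fun _ : Fin 1 => V))) (x : X), g • x = φ g • x :=
    fun _ _ => rfl
  have cfg : Cfg (inV V m).range (cHull X 1 V) (inT V m) (fun k => lV X 1 V (H k)) (max R1 1) := by
    refine ⟨fun g x y => iso (φ g) x y, fp_of_hyp hX, geo_of_geodesicSpace hX.1, hA, ?_, ?_, ?_,
      fun k => (hlR k).le, ?_, ?_, ?_⟩
    · rintro _ ⟨v, rfl⟩
      have := cHull_inv hs iso V v.2
      rw [← hom_inV V H v] at this
      exact this
    · exact fun γ L a b ha hb hγ τ hτ => cHull_qc hs hX V γ L a b ha hb hγ τ hτ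
    · rintro _ ⟨v, rfl⟩ hne x hd
      rw [hact, hφ, hom_inV] at hd
      refine cHull_sd hs V v.2 (fun h => hne ?_) hd
      rw [show v = 1 from Subtype.ext h, map_one]
    · intro k
      obtain ⟨a, ha, b, hb, h⟩ := lV_ex (X := X) V (H k) hA
      refine ⟨a, ha, b, hb, ?_⟩
      rw [hact, hφ, hom_inT]
      exact h
    · intro k g1 h1 g2 h2 a ha b hb
      have he := equiv_update V H k (hom_mem V H k h1) (hom_mem V H k h2)
      have := min_low V H hmin k he
      have h3 := lV_le V (φ g1 * H k * φ g2) ha hb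
      rw [hact, map_mul, map_mul, show φ (inT V m k) = H k from hom_inT V H k]
      linarith
    · intro k g1 h1 g2 h2 x
      have he := equiv_update V H k (hom_mem V H k h1) (hom_mem V H k h2)
      have := (hcon _ _ he).2 k x
      rw [Function.update_self] at this
      rw [hact, map_mul, map_mul, show φ (inT V m k) = H k from hom_inT V H k]
      exact this.le
  apply hnot
  constructor
  · rw [injective_iff_map_eq_one]
    intro w hw
    refine hR1 _ _ _ _ _ _ _ cfg (le_max_left _ _) Finset.univ (by simp) w ?_ ?_
    · rw [KS, Finset.coe_univ, image_univ, gen_top]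
      trivial
    · intro x
      rw [hact, hφ, hw, one_smul]
  · rw [← hφ, MonoidHom.range_eq_map, ← gen_top, MonoidHom.map_closure]
    congr 1
    rw [image_union]
    congr 1
    · ext g
      constructor
      · rintro ⟨_, ⟨v, rfl⟩, rfl⟩
        rw [hφ, hom_inV]; exact v.2
      · intro hg
        exact ⟨_, ⟨⟨g, hg⟩, rfl⟩, hom_inV V H ⟨g, hg⟩⟩
    · rw [← range_comp]
      congr 1
      funext k
      exact hom_inT V H k

end KW

namespace KW

open Pointwise Metric Set

theorem statement4 (m : ℕ) (hm : 1 ≤ m) :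
    ∃ R : ℝ, 0 < R ∧ ∀ (G : Type u) (X : Type v)
      [Group G] [MetricSpace X] [MulAction G X],
      IsometricAction G X → StronglyGeodesic X → DeltaHyperbolic 1 X →
      ∀ (V : Subgroup G) (H : Fin m → G), V ≠ ⊥ → PairMinimal X V H →
        IsFreeProdDecomp (fun _ : Fin 1 => V) H
          (Subgroup.closure ((V : Set G) ∪ Set.range H)) ∨
        ∃ (V' : Subgroup G) (H' : Fin m → G),
          gEquiv ((fun _ : Fin 1 => V), H) ((fun _ : Fin 1 => V'), H') ∧
          ((∃ i : Fin m, lV X 1 V' (H' i) ≤ R) ∨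
           (∃ (i : Fin m) (x : X), dist x (H' i • x) ≤ R)) := by
  exact statement4_aux.{u, v} m hm

end KW
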